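/- arXiv:1307.5857 — 4 statements merged into one kernel-verified Lean document; each statement's English description precedes it below -/
import Mathlib

section
/- Let g : ℝ^d → ℝ be continuous and homogeneous of order α > 0 with ĝ = max_{v ∈ S_{d-1}} g(v) > 0, and let η be a standard Gaussian random vector in ℝ^d. Then the distribution of g(η) restricted to ℝ \ {0} is absolutely continuous with density p_{g(η)}, and for every x > 0, p_{g(η)}(x) = (1/(α x)) ( E[ ‖η‖² · 1{g(η) > x} ] − d · P(g(η) > x) ). Moreover, with ζ uniform on S_{d-1} and the identity p valid for all x > 0: p_{g(η)}(x) = (1/(α x)) ( (α 2^{d/2−1} Γ(d/2))^{−1} ∫_{x/ĝ}^∞ y^{(d+2)/α − 1} e^{−y^{2/α}/2} P(g(ζ) > x/y) dy − d · P(g(η) > x) ). -/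
open MeasureTheory ProbabilityTheory Real Filter Asymptotics Set
open scoped Topology ENNReal

/-- The standard Gaussian measure on `ℝ^d` (independent `N(0,1)` coordinates). -/
noncomputable def stdGaussian (d : ℕ) : Measure (EuclideanSpace ℝ (Fin d)) :=
  (Measure.pi fun _ : Fin d => gaussianReal 0 1).map (EuclideanSpace.equiv (Fin d) ℝ).symm

/-- The uniform distribution on the unit sphere `S_{d-1}`, realized as the law of `η/‖η‖`
for `η` standard Gaussian. -/
noncomputable def uniformSphere (d : ℕ) : Measure (EuclideanSpace ℝ (Fin d)) :=
  (stdGaussian d).map (fun y => ‖y‖⁻¹ • y)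

lemma pi_gaussianReal_eq_withDensity (d : ℕ) :
    (Measure.pi fun _ : Fin d => gaussianReal 0 1) =
      (volume : Measure (Fin d → ℝ)).withDensity
        (fun x => ENNReal.ofReal (∏ i, gaussianPDFReal 0 1 (x i))) := by
  refine (Measure.pi_eq fun s hs => ?_)
  rw [withDensity_apply _ (MeasurableSet.univ_pi hs), volume_pi, Measure.restrict_pi_pi,
    ← ofReal_integral_eq_lintegral_ofReal]
  · rw [integral_fintype_prod_eq_prod (f := fun _ x => gaussianPDFReal 0 1 x),
      ENNReal.ofReal_prod_of_nonneg]
    · exact Finset.prod_congr rfl fun i _ =>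
        (gaussianReal_apply_eq_integral 0 one_ne_zero _).symm
    · exact fun i _ => integral_nonneg (gaussianPDFReal_nonneg _ _)
  · exact Integrable.fintype_prod (f := fun _ x => gaussianPDFReal 0 1 x)
      fun i => (integrable_gaussianPDFReal _ _).restrict
  · exact ae_of_all _ fun x => Finset.prod_nonneg fun i _ => gaussianPDFReal_nonneg _ _ _

lemma prod_gaussianPDFReal (d : ℕ) (x : EuclideanSpace ℝ (Fin d)) :
    ∏ i, gaussianPDFReal 0 1 (x i) = (√(2 * π))⁻¹ ^ d * Real.exp (-‖x‖ ^ 2 / 2) := by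
  simp only [gaussianPDFReal, Finset.prod_mul_distrib, ← Real.exp_sum, EuclideanSpace.norm_sq_eq,
    Finset.prod_const]
  simp [Finset.sum_div, neg_div]

lemma stdGaussian_eq_withDensity (d : ℕ) :
    stdGaussian d = volume.withDensity
      (fun y => ENNReal.ofReal ((√(2 * π))⁻¹ ^ d * Real.exp (-‖y‖ ^ 2 / 2))) := by
  ext s hs
  have hm : Measurable (EuclideanSpace.equiv (Fin d) ℝ).symm :=
    (EuclideanSpace.equiv (Fin d) ℝ).symm.continuous.measurable
  rw [_root_.stdGaussian, Measure.map_apply hm hs, pi_gaussianReal_eq_withDensity,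
    withDensity_apply _ (hm hs), withDensity_apply _ hs,
    ← (PiLp.volume_preserving_toLp (Fin d)).setLIntegral_comp_preimage hs (by fun_prop)]
  refine setLIntegral_congr_fun (hm hs) fun x _ => ?_
  simp only [← prod_gaussianPDFReal]

lemma lintegral_polar {d : ℕ} (hd : 1 ≤ d) {F : EuclideanSpace ℝ (Fin d) → ℝ≥0∞}
    (hF : Measurable F) :
    ∫⁻ y, F y = ∫⁻ v, (∫⁻ r in Ioi (0 : ℝ), ENNReal.ofReal (r ^ (d - 1)) * F (r • v.1))
      ∂(volume : Measure (EuclideanSpace ℝ (Fin d))).toSphere := by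
  have : Nonempty (Fin d) := ⟨⟨0, hd⟩⟩
  have hmp :=
    (volume : Measure (EuclideanSpace ℝ (Fin d))).measurePreserving_homeomorphUnitSphereProd
  calc ∫⁻ y, F y = ∫⁻ y : ({(0)}ᶜ : Set (EuclideanSpace ℝ (Fin d))), F y
        ∂(volume.comap Subtype.val) := by
        rw [lintegral_subtype_comap (measurableSet_singleton _).compl, restrict_compl_singleton]
    _ = ∫⁻ z, F (z.2.1 • z.1.1) ∂(volume : Measure (EuclideanSpace ℝ (Fin d))).toSphere.prod
          (.volumeIoiPow (d - 1)) := by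
        have := hmp.lintegral_comp_emb (Homeomorph.measurableEmbedding _)
          (fun z => F (z.2.1 • z.1.1))
        rw [finrank_euclideanSpace_fin] at this
        rw [← this]
        refine lintegral_congr fun y => ?_
        have hy : ‖y.1‖ ≠ 0 := norm_ne_zero_iff.2 y.2
        simp [smul_smul, hy]
    _ = _ := by
        rw [lintegral_prod _ (by fun_prop)]
        refine lintegral_congr fun v => ?_
        rw [Measure.volumeIoiPow, lintegral_withDensity_eq_lintegral_mul _ (by fun_prop)
          (by fun_prop)]
        exact lintegral_subtype_comap measurableSet_Ioi
          (fun r => ENNReal.ofReal (r ^ (d - 1)) * F (r • v.1))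

/-- The density of the chi distribution with `d` degrees of freedom. -/
noncomputable def chiPDFReal (d : ℕ) (r : ℝ) : ℝ :=
  (2 ^ ((d : ℝ) / 2 - 1) * Real.Gamma ((d : ℝ) / 2))⁻¹ * (r ^ (d - 1) * Real.exp (-r ^ 2 / 2))

lemma measurable_chiPDFReal (d : ℕ) : Measurable (chiPDFReal d) := by
  unfold chiPDFReal; fun_prop

lemma chi_const_pos {d : ℕ} (hd : 1 ≤ d) :
    0 < (2 : ℝ) ^ ((d : ℝ) / 2 - 1) * Real.Gamma ((d : ℝ) / 2) := by
  have : (0 : ℝ) < d := by exact_mod_cast hd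
  have := Real.Gamma_pos_of_pos (half_pos this)
  positivity

lemma chiPDFReal_nonneg {d : ℕ} (hd : 1 ≤ d) {r : ℝ} (hr : 0 ≤ r) : 0 ≤ chiPDFReal d r := by
  have := chi_const_pos hd
  unfold chiPDFReal; positivity

lemma integrableOn_pow_mul_exp_neg_sq (n : ℕ) :
    IntegrableOn (fun r : ℝ => r ^ n * Real.exp (-r ^ 2 / 2)) (Ioi 0) := by
  have h := integrableOn_rpow_mul_exp_neg_mul_sq (b := 1 / 2) (by norm_num) (s := n)
    (by linarith [n.cast_nonneg (α := ℝ)])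
  refine h.congr_fun (fun r _ => ?_) measurableSet_Ioi
  simp only [Real.rpow_natCast]
  ring_nf

lemma integral_pow_mul_exp_neg_sq {d : ℕ} (hd : 1 ≤ d) :
    ∫ r in Ioi (0 : ℝ), r ^ (d - 1) * Real.exp (-r ^ 2 / 2) =
      2 ^ ((d : ℝ) / 2 - 1) * Real.Gamma ((d : ℝ) / 2) := by
  have hd' : (1 : ℝ) ≤ d := by exact_mod_cast hd
  have h := integral_rpow_mul_exp_neg_mul_rpow (p := 2) (q := (d : ℝ) - 1) (b := 1 / 2)
    (by norm_num) (by linarith) (by norm_num)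
  have e : ((2 : ℝ) ^ ((d : ℝ) / 2 - 1)) =
      (1 / 2 : ℝ) ^ (-((d : ℝ) - 1 + 1) / 2) * (1 / 2) := by
    rw [one_div, Real.inv_rpow two_pos.le, ← Real.rpow_neg two_pos.le, Real.rpow_sub two_pos]
    simp [div_eq_mul_inv]
  rw [e, show (d : ℝ) / 2 = (d - 1 + 1) / 2 by ring, ← h]
  refine setIntegral_congr_fun measurableSet_Ioi fun r _ => ?_
  simp only [← Real.rpow_natCast, Nat.cast_sub hd, Nat.cast_one, Nat.cast_ofNat]
  ring_nf

lemma lintegral_stdGaussian_polar {d : ℕ} (hd : 1 ≤ d) {F : EuclideanSpace ℝ (Fin d) → ℝ≥0∞}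
    (hF : Measurable F) :
    ∫⁻ y, F y ∂(stdGaussian d) = ENNReal.ofReal ((√(2 * π))⁻¹ ^ d) *
      ∫⁻ v, (∫⁻ r in Ioi (0 : ℝ),
        ENNReal.ofReal (r ^ (d - 1) * Real.exp (-r ^ 2 / 2)) * F (r • v.1))
      ∂(volume : Measure (EuclideanSpace ℝ (Fin d))).toSphere := by
  rw [stdGaussian_eq_withDensity, lintegral_withDensity_eq_lintegral_mul _ (by fun_prop) hF,
    lintegral_polar hd (by fun_prop), ← lintegral_const_mul' _ _ ENNReal.ofReal_ne_top]
  refine lintegral_congr fun v => ?_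
  rw [← lintegral_const_mul' _ _ ENNReal.ofReal_ne_top]
  refine setLIntegral_congr_fun measurableSet_Ioi fun r (hr : 0 < r) => ?_
  have hv : ‖r • v.1‖ = r := by simp [norm_smul, abs_of_pos hr]
  simp only [Pi.mul_apply, hv]
  rw [ENNReal.ofReal_mul (by positivity), ENNReal.ofReal_mul (by positivity)]
  ring

lemma lintegral_uniformSphere {d : ℕ} (hd : 1 ≤ d) {G : EuclideanSpace ℝ (Fin d) → ℝ≥0∞}
    (hG : Measurable G) :
    ∫⁻ v, G v ∂(uniformSphere d) = ENNReal.ofReal ((√(2 * π))⁻¹ ^ d) *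
      ENNReal.ofReal (2 ^ ((d : ℝ) / 2 - 1) * Real.Gamma ((d : ℝ) / 2)) *
      ∫⁻ v, G v ∂(volume : Measure (EuclideanSpace ℝ (Fin d))).toSphere := by
  have hm : Measurable fun y : EuclideanSpace ℝ (Fin d) => ‖y‖⁻¹ • y := by fun_prop
  rw [uniformSphere, lintegral_map hG hm,
    lintegral_stdGaussian_polar hd (F := fun y => G (‖y‖⁻¹ • y)) (hG.comp hm), mul_assoc]
  congr 1
  rw [← lintegral_const_mul' _ _ ENNReal.ofReal_ne_top]
  refine lintegral_congr fun v => ?_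
  rw [← integral_pow_mul_exp_neg_sq hd, ofReal_integral_eq_lintegral_ofReal
      (integrableOn_pow_mul_exp_neg_sq _) ((ae_restrict_mem measurableSet_Ioi).mono
        fun r (hr : 0 < r) => by simp only [Pi.zero_apply]; positivity),
    ← lintegral_mul_const _ (by fun_prop)]
  refine setLIntegral_congr_fun measurableSet_Ioi fun r (hr : 0 < r) => ?_
  simp [norm_smul, abs_of_pos hr, smul_smul, hr.ne']

lemma lintegral_stdGaussian {d : ℕ} (hd : 1 ≤ d) {F : EuclideanSpace ℝ (Fin d) → ℝ≥0∞}
    (hF : Measurable F) :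
    ∫⁻ y, F y ∂(stdGaussian d) =
      ∫⁻ v, (∫⁻ r in Ioi (0 : ℝ), ENNReal.ofReal (chiPDFReal d r) * F (r • v))
        ∂(uniformSphere d) := by
  have hK := chi_const_pos hd
  rw [lintegral_uniformSphere hd, lintegral_stdGaussian_polar hd hF, mul_assoc]
  · congr 1
    rw [← lintegral_const_mul' _ _ ENNReal.ofReal_ne_top]
    refine lintegral_congr fun v => ?_
    rw [← lintegral_const_mul' _ _ ENNReal.ofReal_ne_top]
    refine lintegral_congr fun r => ?_
    rw [← mul_assoc, ← ENNReal.ofReal_mul hK.le, chiPDFReal, mul_inv_cancel_left₀ hK.ne']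
  · have := measurable_chiPDFReal d
    exact Measurable.lintegral_prod_right'
      (f := fun p : EuclideanSpace ℝ (Fin d) × ℝ =>
        ENNReal.ofReal (chiPDFReal d p.2) * F (p.2 • p.1))
      (by fun_prop)

lemma ae_uniformSphere_norm_eq_one {d : ℕ} (hd : 1 ≤ d) :
    ∀ᵐ v ∂(uniformSphere d), ‖v‖ = 1 := by
  have hs : MeasurableSet {v : EuclideanSpace ℝ (Fin d) | ¬ ‖v‖ = 1} :=
    (measurableSet_eq_fun measurable_norm measurable_const).compl
  rw [ae_iff, ← lintegral_indicator_one hs, lintegral_uniformSphere hd (by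
    exact measurable_one.indicator hs)]
  simp

instance isProbabilityMeasure_stdGaussian (d : ℕ) : IsProbabilityMeasure (stdGaussian d) :=
  Measure.isProbabilityMeasure_map
    (EuclideanSpace.equiv (Fin d) ℝ).symm.continuous.measurable.aemeasurable

instance isProbabilityMeasure_uniformSphere (d : ℕ) : IsProbabilityMeasure (uniformSphere d) :=
  Measure.isProbabilityMeasure_map (by fun_prop)

lemma lintegral_Ioi_comp_rpow {α a : ℝ} (hα : 0 < α) (ha : 0 < a) (F : ℝ → ℝ≥0∞) :
    ∫⁻ r in Ioi (0 : ℝ), F r = ∫⁻ x in Ioi (0 : ℝ),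
      ENNReal.ofReal ((α * x)⁻¹ * (x / a) ^ α⁻¹) * F ((x / a) ^ α⁻¹) := by
  have himg : (fun x : ℝ => (x / a) ^ α⁻¹) '' Ioi 0 = Ioi 0 := by
    ext r
    simp only [mem_image, mem_Ioi]
    constructor
    · rintro ⟨x, hx, rfl⟩
      positivity
    · intro hr
      refine ⟨a * r ^ α, by positivity, ?_⟩
      rw [mul_div_cancel_left₀ _ ha.ne', Real.rpow_rpow_inv hr.le hα.ne']
  have hinj : InjOn (fun x : ℝ => (x / a) ^ α⁻¹) (Ioi 0) := by
    intro x (hx : 0 < x) y (hy : 0 < y) hxy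
    have := (Real.rpow_left_inj (by positivity) (by positivity) (inv_ne_zero hα.ne')).1 hxy
    exact (div_left_inj' ha.ne').1 this
  have hder : ∀ x ∈ Ioi (0 : ℝ), HasDerivWithinAt (fun x : ℝ => (x / a) ^ α⁻¹)
      ((α * x)⁻¹ * (x / a) ^ α⁻¹) (Ioi 0) x := by
    intro x (hx : 0 < x)
    have h := ((hasDerivAt_id x).div_const a).rpow_const (p := α⁻¹) (Or.inl (by positivity))
    refine (h.congr_deriv ?_).hasDerivWithinAt
    rw [Real.rpow_sub (by positivity), Real.rpow_one]
    simp only [id]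
    field_simp
  conv_lhs => rw [← himg]
  rw [lintegral_image_eq_lintegral_abs_deriv_mul measurableSet_Ioi hder hinj]
  refine setLIntegral_congr_fun measurableSet_Ioi fun x (hx : 0 < x) => ?_
  rw [abs_of_nonneg (by positivity)]

lemma lintegral_Ioi_sq_mul_chiPDFReal {d : ℕ} (hd : 1 ≤ d) {R : ℝ} (hR : 0 ≤ R) :
    ∫⁻ r in Ioi R, ENNReal.ofReal (chiPDFReal d r) * ENNReal.ofReal (r ^ 2) =
      ENNReal.ofReal (R * chiPDFReal d R) + d * ∫⁻ r in Ioi R, ENNReal.ofReal (chiPDFReal d r) := by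
  have hsub : Ioi R ⊆ Ioi 0 := Ioi_subset_Ioi hR
  have hnn : ∀ {r}, r ∈ Ioi R → 0 ≤ chiPDFReal d r :=
    fun hr => chiPDFReal_nonneg hd (hsub hr).le
  have h0 : IntegrableOn (chiPDFReal d) (Ioi R) :=
    ((integrableOn_pow_mul_exp_neg_sq (d - 1)).mono_set hsub).const_mul _
  have h1 : IntegrableOn (fun r => r * chiPDFReal d r) (Ioi R) := by
    refine (((integrableOn_pow_mul_exp_neg_sq (d - 1 + 1)).mono_set hsub).const_mul
      (2 ^ ((d : ℝ) / 2 - 1) * Real.Gamma ((d : ℝ) / 2))⁻¹).congr (ae_of_all _ fun r => ?_)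
    simp only [chiPDFReal]; ring
  have h2 : IntegrableOn (fun r => chiPDFReal d r * r ^ 2) (Ioi R) := by
    refine (((integrableOn_pow_mul_exp_neg_sq (d - 1 + 2)).mono_set hsub).const_mul
      (2 ^ ((d : ℝ) / 2 - 1) * Real.Gamma ((d : ℝ) / 2))⁻¹).congr (ae_of_all _ fun r => ?_)
    simp only [chiPDFReal]; ring
  have hder : ∀ r : ℝ, HasDerivAt (fun r => -(r * chiPDFReal d r))
      (chiPDFReal d r * r ^ 2 - d * chiPDFReal d r) r := by
    intro r
    obtain ⟨n, rfl⟩ : ∃ n, d = n + 1 := ⟨d - 1, by omega⟩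
    have he : HasDerivAt (fun r : ℝ => Real.exp (-r ^ 2 / 2)) (Real.exp (-r ^ 2 / 2) * (-r)) r := by
      refine (((hasDerivAt_pow 2 r).neg.div_const 2).exp).congr_deriv ?_
      simp; ring
    have := (((hasDerivAt_id r).mul ((((hasDerivAt_pow n r).mul he)).const_mul
      ((2 : ℝ) ^ (((n + 1 : ℕ) : ℝ) / 2 - 1) * Real.Gamma (((n + 1 : ℕ) : ℝ) / 2))⁻¹))).neg
    refine this.congr_deriv ?_
    rcases n with _ | n
    · simp [chiPDFReal]; ring
    · simp [chiPDFReal]; ring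
  have hint := integral_Ioi_of_hasDerivAt_of_tendsto' (fun r _ => hder r) (h2.sub (h0.const_mul _))
    (tendsto_zero_of_hasDerivAt_of_integrableOn_Ioi (fun r _ => hder r) (h2.sub (h0.const_mul _))
      h1.neg)
  rw [integral_sub h2 (h0.const_mul _), integral_const_mul] at hint
  have hI0 : 0 ≤ ∫ r in Ioi R, chiPDFReal d r :=
    setIntegral_nonneg measurableSet_Ioi fun r hr => hnn hr
  rw [← ofReal_integral_eq_lintegral_ofReal h0 ((ae_restrict_mem measurableSet_Ioi).mono
      fun r hr => hnn hr), ← ENNReal.ofReal_natCast d, ← ENNReal.ofReal_mul (by positivity),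
    ← ENNReal.ofReal_add (mul_nonneg hR (chiPDFReal_nonneg hd hR)) (by positivity),
    show R * chiPDFReal d R + d * ∫ r in Ioi R, chiPDFReal d r =
      ∫ r in Ioi R, chiPDFReal d r * r ^ 2 by linarith,
    ofReal_integral_eq_lintegral_ofReal h2 ((ae_restrict_mem measurableSet_Ioi).mono
      fun r hr => mul_nonneg (hnn hr) (sq_nonneg r))]
  exact setLIntegral_congr_fun measurableSet_Ioi fun r hr => (ENNReal.ofReal_mul (hnn hr)).symm

lemma lt_rpow_mul_iff {α x r a : ℝ} (hα : 0 < α) (hx : 0 < x) (hr : 0 < r) :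
    x < r ^ α * a ↔ 0 < a ∧ (x / a) ^ α⁻¹ < r := by
  have hrα : 0 < r ^ α := by positivity
  constructor
  · intro h
    have ha : 0 < a := pos_of_mul_pos_right (hx.trans h) hrα.le
    exact ⟨ha, (Real.rpow_inv_lt_iff_of_pos (by positivity) hr.le hα).2 ((div_lt_iff₀ ha).2 h)⟩
  · rintro ⟨ha, h⟩
    exact (div_lt_iff₀ ha).1 ((Real.rpow_inv_lt_iff_of_pos (by positivity) hr.le hα).1 h)

/-- For `x > 0`, `(α x)⁻¹` times this is the density at `x` of the law of `g(η)`, when `g` is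
homogeneous of order `α`. -/
noncomputable def sphericalDensity (d : ℕ) (α : ℝ) (g : EuclideanSpace ℝ (Fin d) → ℝ) (x : ℝ) :
    ℝ≥0∞ :=
  ∫⁻ v, (if 0 < g v then
      ENNReal.ofReal ((x / g v) ^ α⁻¹ * chiPDFReal d ((x / g v) ^ α⁻¹)) else 0)
    ∂(uniformSphere d)

section Homogeneous

variable {d : ℕ} {α : ℝ} {g : EuclideanSpace ℝ (Fin d) → ℝ}

lemma setLIntegral_lt_stdGaussian (hd : 1 ≤ d) (hα : 0 < α) (hg : Measurable g)
    (hhom : ∀ c : ℝ, 0 < c → ∀ y, g (c • y) = c ^ α * g y) {x : ℝ} (hx : 0 < x)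
    {f : ℝ → ℝ≥0∞} (hf : Measurable f) :
    ∫⁻ y in {y | x < g y}, f ‖y‖ ∂(stdGaussian d) =
      ∫⁻ v, (if 0 < g v then
        ∫⁻ r in Ioi ((x / g v) ^ α⁻¹), ENNReal.ofReal (chiPDFReal d r) * f r else 0)
        ∂(uniformSphere d) := by
  have hs : MeasurableSet {y | x < g y} := measurableSet_lt measurable_const hg
  rw [← lintegral_indicator hs, lintegral_stdGaussian hd (Measurable.indicator (by fun_prop) hs)]
  refine lintegral_congr_ae ?_
  filter_upwards [ae_uniformSphere_norm_eq_one hd] with v hv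
  have hcongr : ∀ r ∈ Ioi (0 : ℝ), ENNReal.ofReal (chiPDFReal d r) *
      {y | x < g y}.indicator (fun y => f ‖y‖) (r • v) =
      if 0 < g v ∧ (x / g v) ^ α⁻¹ < r then ENNReal.ofReal (chiPDFReal d r) * f r else 0 := by
    intro r (hr : 0 < r)
    simp only [indicator, mem_ofPred_eq, hhom r hr, lt_rpow_mul_iff hα hx hr, norm_smul, hv,
      mul_one, Real.norm_eq_abs, abs_of_pos hr, mul_ite, mul_zero]
  rw [setLIntegral_congr_fun measurableSet_Ioi hcongr]
  split_ifs with hgv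
  · have hR : 0 ≤ (x / g v) ^ α⁻¹ := by positivity
    rw [← inter_eq_left.2 (Ioi_subset_Ioi hR), ← setLIntegral_indicator measurableSet_Ioi]
    simp [hgv, indicator]
  · simp [hgv]

lemma measurable_integrand_sphericalDensity (hg : Measurable g) :
    Measurable fun p : ℝ × EuclideanSpace ℝ (Fin d) => if 0 < g p.2 then
      ENNReal.ofReal ((p.1 / g p.2) ^ α⁻¹ * chiPDFReal d ((p.1 / g p.2) ^ α⁻¹)) else 0 := by
  have := measurable_chiPDFReal d
  refine Measurable.ite (measurableSet_lt measurable_const (by fun_prop)) ?_ measurable_const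
  fun_prop

lemma setLIntegral_norm_sq_stdGaussian (hd : 1 ≤ d) (hα : 0 < α) (hg : Measurable g)
    (hhom : ∀ c : ℝ, 0 < c → ∀ y, g (c • y) = c ^ α * g y) {x : ℝ} (hx : 0 < x) :
    ∫⁻ y in {y | x < g y}, ENNReal.ofReal (‖y‖ ^ 2) ∂(stdGaussian d) =
      sphericalDensity d α g x + d * stdGaussian d {y | x < g y} := by
  have h1 : stdGaussian d {y | x < g y} =
      ∫⁻ y in {y | x < g y}, (fun _ => 1) ‖y‖ ∂(stdGaussian d) := by simp
  rw [h1, setLIntegral_lt_stdGaussian hd hα hg hhom hx measurable_const,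
    setLIntegral_lt_stdGaussian hd hα hg hhom hx (f := fun r => ENNReal.ofReal (r ^ 2))
      (by fun_prop),
    ← lintegral_const_mul' _ _ (ENNReal.natCast_ne_top d), sphericalDensity, ← lintegral_add_left]
  · refine lintegral_congr fun v => ?_
    split_ifs with hgv
    · simp only [mul_one]
      exact lintegral_Ioi_sq_mul_chiPDFReal hd (by positivity)
    · simp
  · exact (measurable_integrand_sphericalDensity hg).comp measurable_prodMk_left

lemma stdGaussian_preimage_eq_lintegral (hd : 1 ≤ d) (hα : 0 < α) (hg : Measurable g)
    (hhom : ∀ c : ℝ, 0 < c → ∀ y, g (c • y) = c ^ α * g y) {s : Set ℝ} (hs : MeasurableSet s)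
    (hs0 : s ⊆ Ioi 0) :
    stdGaussian d (g ⁻¹' s) =
      ∫⁻ x in s, ENNReal.ofReal (α * x)⁻¹ * sphericalDensity d α g x := by
  have hm := measurable_integrand_sphericalDensity (d := d) (α := α) hg
  simp only [sphericalDensity, ← lintegral_const_mul' _ _ ENNReal.ofReal_ne_top]
  rw [lintegral_lintegral_swap, ← lintegral_indicator_one (hg hs),
    lintegral_stdGaussian hd (measurable_one.indicator (hg hs))]
  · refine lintegral_congr fun v => ?_
    have hcongr : ∀ r ∈ Ioi (0 : ℝ), ENNReal.ofReal (chiPDFReal d r) *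
        (g ⁻¹' s).indicator 1 (r • v) =
        ENNReal.ofReal (chiPDFReal d r) * s.indicator 1 (r ^ α * g v) := by
      intro r (hr : 0 < r)
      have hmem : r • v ∈ g ⁻¹' s ↔ r ^ α * g v ∈ s := by rw [mem_preimage, hhom r hr]
      by_cases h : r ^ α * g v ∈ s
      · rw [indicator_of_mem h, indicator_of_mem (hmem.2 h)]; rfl
      · rw [indicator_of_notMem h, indicator_of_notMem (mt hmem.1 h)]
    rw [setLIntegral_congr_fun measurableSet_Ioi hcongr]
    split_ifs with hgv
    · have hres (f : ℝ → ℝ≥0∞) : ∫⁻ x in s, f x = ∫⁻ x in Ioi 0, s.indicator f x := by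
        rw [setLIntegral_indicator hs, inter_eq_left.2 hs0]
      rw [lintegral_Ioi_comp_rpow hα hgv, hres]
      refine setLIntegral_congr_fun measurableSet_Ioi fun x (hx : 0 < x) => ?_
      have hxg : 0 < x / g v := by positivity
      simp only [Real.rpow_inv_rpow hxg.le hα.ne', div_mul_cancel₀ _ hgv.ne']
      by_cases hxs : x ∈ s
      · simp only [hxs, indicator_of_mem, Pi.one_apply, mul_one]
        rw [← ENNReal.ofReal_mul (by positivity), ← ENNReal.ofReal_mul (by positivity), mul_assoc]
      · simp [hxs]
    · simp only [mul_zero, lintegral_zero]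
      refine (setLIntegral_congr_fun measurableSet_Ioi fun r (hr : 0 < r) => ?_).trans
        lintegral_zero
      have : r ^ α * g v ∉ s := fun h => (hs0 h).not_ge
        (mul_nonpos_of_nonneg_of_nonpos (by positivity) (not_lt.1 hgv))
      simp [this]
  · refine Measurable.aemeasurable (Measurable.mul ?_ hm)
    fun_prop

lemma setLIntegral_norm_sq_stdGaussian_eq_radial (hd : 1 ≤ d) (hα : 0 < α) (hg : Measurable g)
    (hhom : ∀ c : ℝ, 0 < c → ∀ y, g (c • y) = c ^ α * g y) {gmax : ℝ}
    (hgmax : gmax ∈ upperBounds (g '' Metric.sphere (0 : EuclideanSpace ℝ (Fin d)) 1))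
    (hgmax_pos : 0 < gmax) {x : ℝ} (hx : 0 < x) :
    ∫⁻ y in {y | x < g y}, ENNReal.ofReal (‖y‖ ^ 2) ∂(stdGaussian d) =
      ENNReal.ofReal (α * 2 ^ ((d:ℝ)/2 - 1) * Real.Gamma ((d:ℝ)/2))⁻¹ *
        ∫⁻ y in Ioi (x / gmax), ENNReal.ofReal
          (y ^ (((d:ℝ)+2)/α - 1) * Real.exp (-(y ^ ((2:ℝ)/α)) / 2) *
            (uniformSphere d {v | x / y < g v}).toReal) := by
  have hs : MeasurableSet {y | x < g y} := measurableSet_lt measurable_const hg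
  have hχ := measurable_chiPDFReal d
  have hK := chi_const_pos hd
  have hG : 0 < Real.Gamma ((d:ℝ)/2) := pos_of_mul_pos_right hK (by positivity)
  have hF : Measurable ({y | x < g y}.indicator fun y => ENNReal.ofReal (‖y‖ ^ 2)) :=
    Measurable.indicator (by fun_prop) hs
  have hzero : ∀ y ∈ Ioi (0 : ℝ), y ∉ Ioi (x / gmax) → uniformSphere d {v | x / y < g v} = 0 := by
    intro y (hy : 0 < y) hyx
    have hyx' : gmax ≤ x / y := by
      rw [le_div_iff₀ hy, mul_comm, ← le_div_iff₀ hgmax_pos]; exact not_lt.1 hyx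
    refine measure_mono_null (fun v (hv : x / y < g v) => ?_) (ae_uniformSphere_norm_eq_one hd)
    intro (h1 : ‖v‖ = 1)
    exact (hgmax ⟨v, by simpa using h1, rfl⟩).not_gt (hyx'.trans_lt hv)
  rw [← lintegral_indicator hs, lintegral_stdGaussian hd hF, lintegral_lintegral_swap,
    lintegral_Ioi_comp_rpow hα one_pos, ← inter_eq_left.2 (Ioi_subset_Ioi (by positivity :
      (0:ℝ) ≤ x / gmax)), ← setLIntegral_indicator measurableSet_Ioi,
    ← lintegral_const_mul' _ _ ENNReal.ofReal_ne_top]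
  · refine setLIntegral_congr_fun measurableSet_Ioi fun y (hy : 0 < y) => ?_
    have hr : 0 < y ^ α⁻¹ := by positivity
    have hχr := chiPDFReal_nonneg hd hr.le
    have hinner : ∫⁻ v, ENNReal.ofReal (chiPDFReal d (y ^ α⁻¹)) *
        {y | x < g y}.indicator (fun y => ENNReal.ofReal (‖y‖ ^ 2)) (y ^ α⁻¹ • v)
          ∂(uniformSphere d) = ENNReal.ofReal (chiPDFReal d (y ^ α⁻¹) * (y ^ α⁻¹) ^ 2) *
          uniformSphere d {v | x / y < g v} := by
      have hs' : MeasurableSet {v | x / y < g v} := measurableSet_lt measurable_const hg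
      rw [← lintegral_indicator_one hs', ← lintegral_const_mul' _ _ ENNReal.ofReal_ne_top]
      refine lintegral_congr_ae ?_
      filter_upwards [ae_uniformSphere_norm_eq_one hd] with v hv
      simp only [indicator, mem_ofPred_eq, hhom _ hr, norm_smul, hv, mul_one, Real.norm_eq_abs,
        abs_of_pos hr, Pi.one_apply, Real.rpow_inv_rpow hy.le hα.ne', div_lt_iff₀ hy,
        mul_comm (g v), ENNReal.ofReal_mul hχr, mul_ite, mul_zero]
    simp only [div_one]
    rw [hinner]
    by_cases hyx : y ∈ Ioi (x / gmax)
    · rw [indicator_of_mem hyx, ← ENNReal.ofReal_toReal (measure_ne_top (uniformSphere d) _),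
        ENNReal.toReal_ofReal ENNReal.toReal_nonneg,
        ← ENNReal.ofReal_mul (by positivity), ← ENNReal.ofReal_mul (by positivity),
        ← ENNReal.ofReal_mul (by positivity)]
      congr 1
      have e1 : y ^ (((d:ℝ)+2)/α - 1) = (y ^ α⁻¹) ^ (d - 1) * (y ^ α⁻¹) ^ 3 / y := by
        rw [← pow_add, show d - 1 + 3 = d + 2 by omega, Real.rpow_sub_one hy.ne',
          ← Real.rpow_natCast, ← Real.rpow_mul hy.le]
        push_cast
        ring_nf
      have e2 : y ^ ((2:ℝ)/α) = (y ^ α⁻¹) ^ 2 := by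
        rw [← Real.rpow_natCast, ← Real.rpow_mul hy.le]
        push_cast
        ring_nf
      rw [e1, e2, chiPDFReal]
      field_simp
    · rw [indicator_of_notMem hyx, hzero y hy hyx]; simp
  · refine Measurable.aemeasurable (Measurable.mul (by fun_prop) ?_)
    exact hF.comp (by fun_prop : Measurable fun p : EuclideanSpace ℝ (Fin d) × ℝ => p.2 • p.1)

lemma lintegral_norm_sq_stdGaussian_ne_top (hd : 1 ≤ d) :
    ∫⁻ y, ENNReal.ofReal (‖y‖ ^ 2) ∂(stdGaussian d) ≠ ∞ := by
  have hconst : ∫⁻ r in Ioi (0 : ℝ), ENNReal.ofReal (chiPDFReal d r) ≠ ∞ :=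
    Integrable.lintegral_lt_top
      ((integrableOn_pow_mul_exp_neg_sq (d - 1)).const_mul _) |>.ne
  rw [lintegral_stdGaussian hd (by fun_prop), lintegral_congr_ae (g := fun _ =>
    ∫⁻ r in Ioi (0 : ℝ), ENNReal.ofReal (chiPDFReal d r) * ENNReal.ofReal (r ^ 2))]
  · rw [lintegral_const, measure_univ, mul_one, lintegral_Ioi_sq_mul_chiPDFReal hd le_rfl]
    exact ENNReal.add_ne_top.2
      ⟨ENNReal.ofReal_ne_top, ENNReal.mul_ne_top (ENNReal.natCast_ne_top d) hconst⟩
  · filter_upwards [ae_uniformSphere_norm_eq_one hd] with v hv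
    simp [norm_smul, hv]

lemma setLIntegral_norm_sq_stdGaussian_ne_top (hd : 1 ≤ d) (s : Set (EuclideanSpace ℝ (Fin d))) :
    ∫⁻ y in s, ENNReal.ofReal (‖y‖ ^ 2) ∂(stdGaussian d) ≠ ∞ :=
  ne_top_of_le_ne_top (lintegral_norm_sq_stdGaussian_ne_top hd) (setLIntegral_le_lintegral _ _)

lemma setIntegral_norm_sq_stdGaussian (s : Set (EuclideanSpace ℝ (Fin d))) :
    ∫ y in s, ‖y‖ ^ 2 ∂(stdGaussian d) =
      (∫⁻ y in s, ENNReal.ofReal (‖y‖ ^ 2) ∂(stdGaussian d)).toReal :=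
  integral_eq_lintegral_of_nonneg_ae (ae_of_all _ fun y => by positivity)
    (by fun_prop : Measurable fun y : EuclideanSpace ℝ (Fin d) => ‖y‖ ^ 2).aestronglyMeasurable

lemma setIntegral_norm_sq_stdGaussian_sub (hd : 1 ≤ d) (hα : 0 < α) (hg : Measurable g)
    (hhom : ∀ c : ℝ, 0 < c → ∀ y, g (c • y) = c ^ α * g y) {x : ℝ} (hx : 0 < x) :
    (∫ y in {y | x < g y}, ‖y‖ ^ 2 ∂(stdGaussian d)) - d * (stdGaussian d {y | x < g y}).toReal =
      (sphericalDensity d α g x).toReal := by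
  have hJ := setLIntegral_norm_sq_stdGaussian hd hα hg hhom hx
  have hfin := setLIntegral_norm_sq_stdGaussian_ne_top hd {y | x < g y}
  rw [hJ] at hfin
  obtain ⟨h1, h2⟩ := ENNReal.add_ne_top.1 hfin
  rw [setIntegral_norm_sq_stdGaussian, hJ, ENNReal.toReal_add h1 h2, ENNReal.toReal_mul]
  simp

lemma ofReal_density_eq (hd : 1 ≤ d) (hα : 0 < α) (hg : Measurable g)
    (hhom : ∀ c : ℝ, 0 < c → ∀ y, g (c • y) = c ^ α * g y) {x : ℝ} (hx : 0 < x) :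
    ENNReal.ofReal ((α * x)⁻¹ * (sphericalDensity d α g x).toReal) =
      ENNReal.ofReal (α * x)⁻¹ * sphericalDensity d α g x := by
  have hJ := setLIntegral_norm_sq_stdGaussian hd hα hg hhom hx
  have hfin := setLIntegral_norm_sq_stdGaussian_ne_top hd {y | x < g y}
  rw [hJ] at hfin
  rw [ENNReal.ofReal_mul (by positivity), ENNReal.ofReal_toReal (ENNReal.add_ne_top.1 hfin).1]

lemma setIntegral_norm_sq_stdGaussian_eq_radial (hd : 1 ≤ d) (hα : 0 < α) (hg : Measurable g)
    (hhom : ∀ c : ℝ, 0 < c → ∀ y, g (c • y) = c ^ α * g y) {gmax : ℝ}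
    (hgmax : gmax ∈ upperBounds (g '' Metric.sphere (0 : EuclideanSpace ℝ (Fin d)) 1))
    (hgmax_pos : 0 < gmax) {x : ℝ} (hx : 0 < x) :
    ∫ y in {y | x < g y}, ‖y‖ ^ 2 ∂(stdGaussian d) =
      (α * 2 ^ ((d:ℝ)/2 - 1) * Real.Gamma ((d:ℝ)/2))⁻¹ *
        ∫ y in Ioi (x / gmax), y ^ (((d:ℝ)+2)/α - 1) * Real.exp (-(y ^ ((2:ℝ)/α)) / 2) *
            (uniformSphere d {v | x / y < g v}).toReal := by
  have hK := chi_const_pos hd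
  have hU : Measurable fun y : ℝ => uniformSphere d {v | x / y < g v} :=
    measurable_measure_prodMk_left (ν := uniformSphere d)
      (s := {p : ℝ × EuclideanSpace ℝ (Fin d) | x / p.1 < g p.2})
      (measurableSet_lt (by fun_prop) (by fun_prop))
  rw [setIntegral_norm_sq_stdGaussian,
    setLIntegral_norm_sq_stdGaussian_eq_radial hd hα hg hhom hgmax hgmax_pos hx,
    ENNReal.toReal_mul, ENNReal.toReal_ofReal (by rw [mul_assoc]; positivity),
    integral_eq_lintegral_of_nonneg_ae]
  · filter_upwards [ae_restrict_mem measurableSet_Ioi] with y hy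
    have : 0 < y := (div_pos hx hgmax_pos).trans hy
    simp only [Pi.zero_apply]
    positivity
  · exact Measurable.aestronglyMeasurable (by fun_prop)

end Homogeneous

/-- for `g` continuous and homogeneous of order `α > 0` with `ĝ > 0` and `η`
standard Gaussian, the law of `g(η)` restricted to `ℝ \ {0}` has a density `p` with, for
`x > 0`, `p(x) = (αx)⁻¹ (E[‖η‖²; g(η) > x] − d P(g(η) > x))`, and also
`p(x) = (αx)⁻¹ ((α2^{d/2−1}Γ(d/2))⁻¹ ∫_{x/ĝ}^∞ y^{(d+2)/α−1} e^{−y^{2/α}/2} P(g(ζ) > x/y) dy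
− d P(g(η) > x))` with `ζ` uniform on the sphere. -/
theorem density_representation_gaussian_chaos
    (d : ℕ) (hd : 1 ≤ d) (α : ℝ) (hα : 0 < α)
    (g : EuclideanSpace ℝ (Fin d) → ℝ) (hg_cont : Continuous g)
    (hhom : ∀ c : ℝ, 0 < c → ∀ y, g (c • y) = c ^ α * g y)
    (gmax : ℝ)
    (hgmax : IsGreatest (g '' Metric.sphere (0 : EuclideanSpace ℝ (Fin d)) 1) gmax)
    (hgmax_pos : 0 < gmax) :
    ∃ p : ℝ → ℝ,
      (Measure.map g (stdGaussian d)).restrict {(0:ℝ)}ᶜ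
        = (volume.restrict {(0:ℝ)}ᶜ).withDensity (fun x => ENNReal.ofReal (p x)) ∧
      (∀ x : ℝ, 0 < x →
        p x = (α * x)⁻¹ *
          ((∫ y in {y : EuclideanSpace ℝ (Fin d) | x < g y}, ‖y‖ ^ 2 ∂(stdGaussian d))
            - d * (stdGaussian d {y | x < g y}).toReal)) ∧
      (∀ x : ℝ, 0 < x →
        p x = (α * x)⁻¹ *
          ((α * 2 ^ ((d:ℝ)/2 - 1) * Real.Gamma ((d:ℝ)/2))⁻¹ *
            (∫ y in Set.Ioi (x / gmax),
              y ^ (((d:ℝ)+2)/α - 1) * Real.exp (-(y ^ ((2:ℝ)/α)) / 2) *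
                (uniformSphere d {v | x / y < g v}).toReal)
            - d * (stdGaussian d {y | x < g y}).toReal)) := by
  have hg := hg_cont.measurable
  have hhom' : ∀ c : ℝ, 0 < c → ∀ y, (-g) (c • y) = c ^ α * (-g) y := fun c hc y => by
    simp [hhom c hc y]
  refine ⟨fun x => if 0 < x then (α * x)⁻¹ * (sphericalDensity d α g x).toReal
    else (α * -x)⁻¹ * (sphericalDensity d α (-g) (-x)).toReal, ?_, fun x hx => ?_, fun x hx => ?_⟩
  · ext s hs
    have h0 : MeasurableSet ({0}ᶜ : Set ℝ) := (measurableSet_singleton 0).compl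
    have hpos : MeasurableSet (s ∩ Ioi 0) := hs.inter measurableSet_Ioi
    have hneg : MeasurableSet (s ∩ Iio 0) := hs.inter measurableSet_Iio
    have hsplit : s ∩ {0}ᶜ = s ∩ Ioi 0 ∪ s ∩ Iio 0 := by
      rw [← inter_union_distrib_left, union_comm, Iio_union_Ioi]
    have hdisj : Disjoint (s ∩ Ioi 0) (s ∩ Iio 0) :=
      disjoint_left.2 fun x h1 h2 => lt_asymm (α := ℝ) h1.2 h2.2
    rw [Measure.restrict_apply hs, withDensity_apply _ hs, Measure.restrict_restrict hs, hsplit,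
      measure_union hdisj hneg, lintegral_union hneg hdisj, Measure.map_apply hg hpos,
      Measure.map_apply hg hneg]
    congr 1
    · rw [stdGaussian_preimage_eq_lintegral hd hα hg hhom hpos inter_subset_right]
      refine setLIntegral_congr_fun hpos fun x hx => ?_
      have hx0 : 0 < x := hx.2
      simp only [hx0, if_true, ofReal_density_eq hd hα hg hhom hx0]
    · have hpre : g ⁻¹' (s ∩ Iio 0) = (-g) ⁻¹' ((fun x => -x) ⁻¹' (s ∩ Iio 0)) := by
        ext y; simp
      have hinv : Neg.neg ⁻¹' (Neg.neg ⁻¹' (s ∩ Iio 0)) = s ∩ Iio 0 := by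
        rw [preimage_preimage]; simp
      rw [hpre, stdGaussian_preimage_eq_lintegral hd hα hg.neg hhom' (measurable_neg hneg)
          fun x hx => by simpa using hx.2,
        ← (Measure.measurePreserving_neg (volume : Measure ℝ)).setLIntegral_comp_preimage_emb
          (MeasurableEquiv.neg ℝ).measurableEmbedding, hinv]
      refine setLIntegral_congr_fun hneg fun x hx => ?_
      have hx0 : x < 0 := hx.2
      simp only [hx0.not_gt, if_false, ofReal_density_eq hd hα hg.neg hhom' (neg_pos.2 hx0)]
  · simp only [if_pos hx]
    rw [setIntegral_norm_sq_stdGaussian_sub hd hα hg hhom hx]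
  · simp only [if_pos hx]
    rw [← setIntegral_norm_sq_stdGaussian_sub hd hα hg hhom hx,
      setIntegral_norm_sq_stdGaussian_eq_radial hd hα hg hhom hgmax.2 hgmax_pos hx]
end

section
/- Let (ξ_1, ξ_2) be a centered Gaussian vector with Var ξ_1 = Var ξ_2 = 1 and correlation coefficient ρ ∈ (−1, 1]. Then as x → ∞: P(ξ_1 ξ_2 > x) = ((1+ρ)/√(2π)) x^{−1/2} e^{−x/(1+ρ)} (1 + O(1/x)), and the density of ξ_1 ξ_2 satisfies p_{ξ_1 ξ_2}(x) = (1/√(2π)) x^{−1/2} e^{−x/(1+ρ)} (1 + O(1/x)). -/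
open MeasureTheory ProbabilityTheory Real Filter Asymptotics Set
open scoped Topology ENNReal

/-- The coordinates of a standard Gaussian vector in the plane are independent standard normals. -/
lemma map_coord_stdGaussian_two :
    (_root_.stdGaussian 2).map (fun y => (y 0, y 1))
      = (gaussianReal 0 1).prod (gaussianReal 0 1) := by
  rw [_root_.stdGaussian, Measure.map_map (by fun_prop) (by fun_prop)]
  exact (measurePreserving_finTwoArrow (gaussianReal 0 1)).map_eq

/-- By rotation invariance, the product of the two coordinates of the correlated vector has the
law of an indefinite diagonal quadratic form in independent standard normals. -/
lemma map_mul_eq_map_quadratic {ρ : ℝ} (hρ₁ : -1 ≤ ρ) (hρ₂ : ρ ≤ 1)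
    {Ω : Type*} [MeasurableSpace Ω] {μ : Measure Ω} {ξ₁ ξ₂ : Ω → ℝ}
    (hξ : AEMeasurable (fun ω => (ξ₁ ω, ξ₂ ω)) μ)
    (hlaw : Measure.map (fun ω => (ξ₁ ω, ξ₂ ω)) μ
      = Measure.map (fun y : EuclideanSpace ℝ (Fin 2) =>
          ((√(1 + ρ) / 2 + √(1 - ρ) / 2) * y 0 + (√(1 + ρ) / 2 - √(1 - ρ) / 2) * y 1,
            (√(1 + ρ) / 2 - √(1 - ρ) / 2) * y 0 + (√(1 + ρ) / 2 + √(1 - ρ) / 2) * y 1))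
          (_root_.stdGaussian 2)) :
    μ.map (fun ω => ξ₁ ω * ξ₂ ω)
      = ((gaussianReal 0 1).prod (gaussianReal 0 1)).map
          (fun z : ℝ × ℝ => ((1 + ρ) * z.1 ^ 2 - (1 - ρ) * z.2 ^ 2) / 2) := by
  have hmul : Measurable (fun z : ℝ × ℝ => z.1 * z.2) := by fun_prop
  have h1 : μ.map (fun ω => ξ₁ ω * ξ₂ ω)
      = (μ.map (fun ω => (ξ₁ ω, ξ₂ ω))).map (fun z : ℝ × ℝ => z.1 * z.2) :=
    (AEMeasurable.map_map_of_aemeasurable hmul.aemeasurable hξ).symm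
  rw [h1, hlaw, Measure.map_map hmul (by fun_prop)]
  conv_rhs => rw [← IsGaussian.map_rotation_eq_self (μ := gaussianReal 0 1)
    integral_id_gaussianReal (π / 4), ← map_coord_stdGaussian_two]
  rw [Measure.map_map (by fun_prop) (by fun_prop), Measure.map_map (by fun_prop) (by fun_prop)]
  congr 1
  funext y
  simp only [Function.comp_apply, ContinuousLinearMap.rotation_apply, cos_pi_div_four,
    sin_pi_div_four, smul_eq_mul]
  have e2 : √2 ^ 2 = 2 := sq_sqrt (by norm_num)
  have ea : √(1 + ρ) ^ 2 = 1 + ρ := sq_sqrt (by linarith)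
  have eb : √(1 - ρ) ^ 2 = 1 - ρ := sq_sqrt (by linarith)
  linear_combination (y 0 + y 1) ^ 2 / 4 * ea - (y 0 - y 1) ^ 2 / 4 * eb
    - ((1 + ρ) * (y 0 + y 1) ^ 2 - (1 - ρ) * (y 0 - y 1) ^ 2) / 8 * e2

/-- The density on `(0, ∞)` of `(a u² - b v²) / 2` for fixed `v` and standard normal `u`. -/
noncomputable def quadraticKernel (a b t v : ℝ) : ℝ :=
  2 / √(2 * π * a) * ((√(2 * t + b * v ^ 2))⁻¹ * exp (-(2 * t + b * v ^ 2) / (2 * a)))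

/-- The density on `(0, ∞)` of `(a u² - b v²) / 2` for independent standard normals `u`, `v`. -/
noncomputable def quadraticDensity (a b t : ℝ) : ℝ :=
  ∫ v, quadraticKernel a b t v ∂gaussianReal 0 1

lemma measurable_quadraticKernel (a b : ℝ) :
    Measurable (fun z : ℝ × ℝ => quadraticKernel a b z.1 z.2) := by
  unfold quadraticKernel
  fun_prop

lemma quadraticKernel_nonneg (a b t v : ℝ) : 0 ≤ quadraticKernel a b t v := by
  unfold quadraticKernel
  positivity

lemma gaussianReal_preimage_quadratic {a b : ℝ} (ha : 0 < a) (hb : 0 ≤ b) (v : ℝ) {s : Set ℝ}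
    (hs : MeasurableSet s) (hs0 : s ⊆ Ioi 0) :
    gaussianReal 0 1 {u | (a * u ^ 2 - b * v ^ 2) / 2 ∈ s}
      = ∫⁻ t in s, ENNReal.ofReal (quadraticKernel a b t v) := by
  set A : Set ℝ := {u | (a * u ^ 2 - b * v ^ 2) / 2 ∈ s} with hA
  have hAm : MeasurableSet A := (by fun_prop : Measurable fun u : ℝ => _) hs
  set f : ℝ → ℝ := fun t => √((2 * t + b * v ^ 2) / a) with hf
  have hbv : 0 ≤ b * v ^ 2 := by positivity
  have hpos : ∀ t ∈ s, 0 < (2 * t + b * v ^ 2) / a := fun t ht => by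
    have : 0 < t := hs0 ht
    positivity
  have hinv : ∀ t ∈ s, (a * f t ^ 2 - b * v ^ 2) / 2 = t := fun t ht => by
    rw [hf, sq_sqrt (hpos t ht).le]
    field_simp
    ring
  have himg : A ∩ Ioi 0 = f '' s := by
    ext u
    constructor
    · rintro ⟨hu, hu0⟩
      refine ⟨_, hu, ?_⟩
      simp only [hf]
      rw [show (2 * ((a * u ^ 2 - b * v ^ 2) / 2) + b * v ^ 2) / a = u ^ 2 by field_simp; ring]
      exact sqrt_sq (le_of_lt hu0)
    · rintro ⟨t, ht, rfl⟩
      exact ⟨by rw [hA, mem_ofPred_eq, hinv t ht]; exact ht, sqrt_pos.2 (hpos t ht)⟩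
  have hneg : gaussianReal 0 1 (A ∩ Iio 0) = gaussianReal 0 1 (A ∩ Ioi 0) := by
    conv_lhs => rw [← neg_zero (G := ℝ), ← gaussianReal_map_neg, neg_zero]
    rw [Measure.map_apply (by fun_prop) (hAm.inter measurableSet_Iio)]
    congr 1
    ext u
    simp [hA]
  have hsplit : A = (A ∩ Iio 0) ∪ (A ∩ Ioi 0) := by
    ext u
    refine ⟨fun hu => ?_, fun hu => hu.elim (·.1) (·.1)⟩
    rcases lt_trichotomy u 0 with h | h | h
    · exact Or.inl ⟨hu, h⟩
    · have : (0 : ℝ) < (a * u ^ 2 - b * v ^ 2) / 2 := hs0 hu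
      rw [h] at this
      nlinarith
    · exact Or.inr ⟨hu, h⟩
  have hdisj : Disjoint (A ∩ Iio 0) (A ∩ Ioi 0) :=
    Set.disjoint_left.2 fun u h h' => lt_asymm (mem_Iio.1 h.2) (mem_Ioi.1 h'.2)
  have hderiv : ∀ t ∈ s, HasDerivWithinAt f (2 / a / (2 * f t)) s t := fun t ht => by
    have h1 : HasDerivAt (fun t : ℝ => (2 * t + b * v ^ 2) / a) (2 / a) t := by
      simpa using (((hasDerivAt_id t).const_mul 2).add_const (b * v ^ 2)).div_const a
    exact (h1.sqrt (hpos t ht).ne').hasDerivWithinAt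
  have hinj : InjOn f s := fun t ht t' ht' h => by
    rw [← hinv t ht, ← hinv t' ht', h]
  rw [hsplit, measure_union hdisj (hAm.inter measurableSet_Ioi), hneg, ← two_mul, himg,
    gaussianReal_apply _ one_ne_zero,
    lintegral_image_eq_lintegral_abs_deriv_mul hs hderiv hinj,
    ← lintegral_const_mul' _ _ (by norm_num)]
  refine setLIntegral_congr_fun hs fun t ht => ?_
  have hft : 0 < f t := sqrt_pos.2 (hpos t ht)
  have h2 : (0 : ℝ) < 2 * t + b * v ^ 2 := by
    have := hpos t ht
    rwa [div_pos_iff_of_pos_right ha] at this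
  simp only [gaussianPDF]
  rw [abs_of_pos (by positivity), show (2 : ℝ≥0∞) = ENNReal.ofReal 2 by simp,
    ← ENNReal.ofReal_mul (by positivity), ← ENNReal.ofReal_mul (by positivity)]
  congr 1
  rw [gaussianPDFReal, quadraticKernel]
  have e1 : -(f t - 0) ^ 2 / (2 * ((1 : NNReal) : ℝ)) = -(2 * t + b * v ^ 2) / (2 * a) := by
    rw [hf, sub_zero, sq_sqrt (hpos t ht).le, NNReal.coe_one]
    field_simp
  rw [e1]
  have e2 : f t = √(2 * t + b * v ^ 2) / √a := sqrt_div' _ ha.le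
  have e3 : √(2 * π * a) = √(2 * π) * √a := sqrt_mul (by positivity) _
  have e4 : √a ^ 2 = a := sq_sqrt ha.le
  have h5 : 0 < √a := sqrt_pos.2 ha
  have h6 : 0 < √(2 * t + b * v ^ 2) := sqrt_pos.2 h2
  rw [e2, e3, NNReal.coe_one, mul_one]
  field_simp
  linear_combination e4

lemma integrable_quadraticKernel {a b t : ℝ} (ha : 0 < a) (hb : 0 ≤ b) (ht : 0 < t) :
    Integrable (quadraticKernel a b t) (gaussianReal 0 1) := by
  refine Integrable.of_bound
    ((measurable_quadraticKernel a b).comp measurable_prodMk_left).aestronglyMeasurable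
    (2 / √(2 * π * a) * ((√(2 * t))⁻¹ * 1)) (ae_of_all _ fun v => ?_)
  have hbv : 0 ≤ b * v ^ 2 := by positivity
  rw [norm_of_nonneg (quadraticKernel_nonneg a b t v), quadraticKernel]
  gcongr
  · linarith
  · rw [exp_le_one_iff]
    exact div_nonpos_of_nonpos_of_nonneg (by linarith) (by positivity)

lemma quadraticDensity_nonneg (a b t : ℝ) : 0 ≤ quadraticDensity a b t :=
  integral_nonneg fun v => quadraticKernel_nonneg a b t v

lemma measurable_quadraticDensity (a b : ℝ) : Measurable (quadraticDensity a b) :=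
  ((measurable_quadraticKernel a b).stronglyMeasurable.integral_prod_right
    (ν := gaussianReal 0 1)).measurable

lemma map_quadratic_restrict_Ioi {a b : ℝ} (ha : 0 < a) (hb : 0 ≤ b) :
    (((gaussianReal 0 1).prod (gaussianReal 0 1)).map
        (fun z : ℝ × ℝ => (a * z.1 ^ 2 - b * z.2 ^ 2) / 2)).restrict (Ioi 0)
      = (volume.restrict (Ioi 0)).withDensity
          (fun t => ENNReal.ofReal (quadraticDensity a b t)) := by
  ext s hs
  have hm : Measurable (fun z : ℝ × ℝ => (a * z.1 ^ 2 - b * z.2 ^ 2) / 2) := by fun_prop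
  have hs' : MeasurableSet (s ∩ Ioi 0) := hs.inter measurableSet_Ioi
  rw [Measure.restrict_apply hs, withDensity_apply _ hs, Measure.restrict_restrict hs,
    Measure.map_apply hm hs', Measure.prod_apply_symm (hm hs')]
  calc _ = ∫⁻ v, ∫⁻ t in s ∩ Ioi 0, ENNReal.ofReal (quadraticKernel a b t v) ∂volume
          ∂gaussianReal 0 1 :=
        lintegral_congr fun v => gaussianReal_preimage_quadratic ha hb v hs' inter_subset_right
    _ = ∫⁻ t in s ∩ Ioi 0, ∫⁻ v, ENNReal.ofReal (quadraticKernel a b t v) ∂gaussianReal 0 1 :=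
        lintegral_lintegral_swap
          ((measurable_quadraticKernel a b).comp measurable_swap).ennreal_ofReal.aemeasurable
    _ = _ := setLIntegral_congr_fun hs' fun t ht =>
        (ofReal_integral_eq_lintegral_ofReal (integrable_quadraticKernel ha hb ht.2)
          (ae_of_all _ (quadraticKernel_nonneg a b t))).symm

lemma integral_exp_neg_mul_sq_gaussianReal {c : ℝ} (hc : 0 ≤ c) :
    ∫ v, exp (-c * v ^ 2) ∂gaussianReal 0 1 = (√(1 + 2 * c))⁻¹ := by
  rw [integral_gaussianReal_eq_integral_smul one_ne_zero]
  have h : ∀ v : ℝ, gaussianPDFReal 0 1 v • exp (-c * v ^ 2)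
      = (√(2 * π))⁻¹ * exp (-(1 / 2 + c) * v ^ 2) := fun v => by
    rw [gaussianPDFReal, smul_eq_mul, mul_assoc, ← exp_add, NNReal.coe_one, mul_one]
    congr 2
    ring
  simp_rw [h]
  rw [integral_const_mul, integral_gaussian, ← sqrt_inv, ← sqrt_mul (by positivity), ← sqrt_inv]
  congr 1
  have := pi_pos
  field_simp

lemma integrable_sq_gaussianReal : Integrable (fun v : ℝ => v ^ 2) (gaussianReal 0 1) :=
  (memLp_id_gaussianReal 2).integrable_sq

lemma inv_sqrt_sub_inv_sqrt_add_le {x y : ℝ} (hx : 0 < x) (hy : 0 ≤ y) :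
    (√x)⁻¹ - (√(x + y))⁻¹ ≤ (√x)⁻¹ * (y / (2 * x)) := by
  set r := √x with hr
  set q := √(x + y) with hq
  have hr0 : 0 < r := sqrt_pos.2 hx
  have hrq : r ≤ q := sqrt_le_sqrt (by linarith)
  have hr2 : r ^ 2 = x := sq_sqrt hx.le
  have hq2 : q ^ 2 = x + y := sq_sqrt (by linarith)
  have hq0 : 0 < q := hr0.trans_le hrq
  have hy' : y = q ^ 2 - r ^ 2 := by linarith
  rw [hy', ← hr2, ← sub_nonneg]
  have : r⁻¹ * ((q ^ 2 - r ^ 2) / (2 * r ^ 2)) - (r⁻¹ - q⁻¹)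
      = (q - r) ^ 2 * (q + 2 * r) / (2 * r ^ 3 * q) := by
    field_simp
    ring
  rw [this]
  positivity

/-- The density agrees with its leading term up to a relative error of order `1 / t`. -/
lemma exists_abs_quadraticDensity_sub_le {a b : ℝ} (ha : 0 < a) (hb : 0 ≤ b) (hab : a + b = 2) :
    ∃ C, ∀ t, 0 < t →
      |quadraticDensity a b t - (√(2 * π))⁻¹ * ((√t)⁻¹ * exp (-t / a))|
        ≤ C * ((√t)⁻¹ * exp (-t / a) * t⁻¹) := by
  set M : ℝ := ∫ v, v ^ 2 ∂gaussianReal 0 1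
  refine ⟨2 / √(2 * π * a) * (√2)⁻¹ * (b / 4) * M, fun t ht => ?_⟩
  have hg : ∀ v : ℝ, exp (-(b / (2 * a)) * v ^ 2) ≤ 1 := fun v => by
    rw [exp_le_one_iff, neg_mul, neg_nonpos]
    positivity
  set G : ℝ → ℝ := fun v =>
    2 / √(2 * π * a) * ((√(2 * t))⁻¹ * (exp (-t / a) * exp (-(b / (2 * a)) * v ^ 2))) with hG
  have hGi : Integrable G (gaussianReal 0 1) := by
    refine Integrable.of_bound (by fun_prop)
      (2 / √(2 * π * a) * ((√(2 * t))⁻¹ * (exp (-t / a) * 1))) (ae_of_all _ fun v => ?_)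
    rw [norm_of_nonneg (by positivity)]
    simp only [hG]
    gcongr
    exact hg v
  have hGint : ∫ v, G v ∂gaussianReal 0 1 = (√(2 * π))⁻¹ * ((√t)⁻¹ * exp (-t / a)) := by
    simp only [hG]
    rw [integral_const_mul, integral_const_mul, integral_const_mul,
      integral_exp_neg_mul_sq_gaussianReal (by positivity),
      show 1 + 2 * (b / (2 * a)) = 2 / a by rw [← hab]; field_simp,
      sqrt_mul (by positivity) a, sqrt_mul zero_le_two t, sqrt_div zero_le_two]
    have e2 : √2 ^ 2 = 2 := sq_sqrt (by norm_num)
    have h2 : 0 < √2 := by positivity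
    have h3 : 0 < √a := by positivity
    have h4 : 0 < √t := by positivity
    have h5 : 0 < √(2 * π) := by positivity
    field_simp
    linarith
  rw [quadraticDensity, ← hGint, ← integral_sub (integrable_quadraticKernel ha hb ht) hGi]
  have hbound : ∀ v, ‖quadraticKernel a b t v - G v‖
      ≤ 2 / √(2 * π * a) * (√2)⁻¹ * (b / 4) * ((√t)⁻¹ * exp (-t / a) * t⁻¹) * v ^ 2 := fun v => by
    have hbv : 0 ≤ b * v ^ 2 := by positivity
    have he : exp (-(2 * t + b * v ^ 2) / (2 * a))
        = exp (-t / a) * exp (-(b / (2 * a)) * v ^ 2) := by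
      rw [← exp_add]
      congr 1
      field_simp
      ring
    have hk : quadraticKernel a b t v - G v
        = -(2 / √(2 * π * a) * (((√(2 * t))⁻¹ - (√(2 * t + b * v ^ 2))⁻¹)
          * (exp (-t / a) * exp (-(b / (2 * a)) * v ^ 2)))) := by
      simp only [quadraticKernel, hG, he]
      ring
    have hd : 0 ≤ (√(2 * t))⁻¹ - (√(2 * t + b * v ^ 2))⁻¹ := by
      rw [sub_nonneg]
      gcongr
      linarith
    rw [hk, norm_neg, norm_of_nonneg (by positivity)]
    calc _ ≤ 2 / √(2 * π * a) * ((√(2 * t))⁻¹ * (b * v ^ 2 / (2 * (2 * t)))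
          * (exp (-t / a) * 1)) := by
          gcongr
          · exact inv_sqrt_sub_inv_sqrt_add_le (by positivity) hbv
          · exact hg v
      _ = _ := by
          rw [sqrt_mul zero_le_two t, mul_inv]
          field_simp
          ring
  calc |∫ v, (quadraticKernel a b t v - G v) ∂gaussianReal 0 1|
      ≤ ∫ v, 2 / √(2 * π * a) * (√2)⁻¹ * (b / 4) * ((√t)⁻¹ * exp (-t / a) * t⁻¹) * v ^ 2
          ∂gaussianReal 0 1 :=
        norm_integral_le_of_norm_le (integrable_sq_gaussianReal.const_mul _) (ae_of_all _ hbound)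
    _ = _ := by
        rw [integral_const_mul]
        ring

lemma hasDerivAt_inv_sqrt_mul_exp {a t : ℝ} (ht : 0 < t) :
    HasDerivAt (fun t => (√t)⁻¹ * exp (-t / a))
      (-((√t)⁻¹ * exp (-t / a) * t⁻¹ / 2 + (√t)⁻¹ * exp (-t / a) / a)) t := by
  have h1 := (hasDerivAt_sqrt ht.ne').inv (sqrt_pos.2 ht).ne'
  have h2 : HasDerivAt (fun t : ℝ => exp (-t / a)) (exp (-t / a) * (-1 / a)) t :=
    (((hasDerivAt_id t).neg).div_const a).exp
  refine (h1.mul h2).congr_deriv ?_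
  have h4 : 0 < √t := sqrt_pos.2 ht
  rw [Pi.inv_apply, sq_sqrt ht.le]
  field_simp
  ring

lemma tendsto_inv_sqrt_mul_exp {a : ℝ} (ha : 0 < a) :
    Tendsto (fun t => (√t)⁻¹ * exp (-t / a)) atTop (𝓝 0) := by
  have h1 : Tendsto (fun t : ℝ => (√t)⁻¹) atTop (𝓝 0) :=
    tendsto_sqrt_atTop.inv_tendsto_atTop
  have h2 : Tendsto (fun t : ℝ => exp (-t / a)) atTop (𝓝 0) := by
    refine tendsto_exp_atBot.comp ?_
    exact (tendsto_neg_atTop_atBot).atBot_div_const ha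
  simpa using h1.mul h2

/-- Integrating a density asymptotic to `c t ^ (-1/2) e ^ (-t/a)` with relative error `O(1/t)`. -/
lemma abs_integral_Ioi_sub_le {a c C : ℝ} (ha : 0 < a) {p : ℝ → ℝ} (hp : Measurable p)
    (hpC : ∀ t, 0 < t → |p t - c * ((√t)⁻¹ * exp (-t / a))|
        ≤ C * ((√t)⁻¹ * exp (-t / a) * t⁻¹)) {x : ℝ} (hx : 0 < x) :
    IntegrableOn p (Ioi x) ∧
      |(∫ t in Ioi x, p t) - a * c * ((√x)⁻¹ * exp (-x / a))|
        ≤ (C + a * |c| / 2) * a * ((√x)⁻¹ * exp (-x / a) * x⁻¹) := by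
  set h : ℝ → ℝ := fun t => (√t)⁻¹ * exp (-t / a) with hh
  set h' : ℝ → ℝ := fun t => -(h t * t⁻¹ / 2 + h t / a) with hh'
  have hC : 0 ≤ C := by
    have h1 := (abs_nonneg _).trans (hpC 1 one_pos)
    have h2 : 0 < (√(1 : ℝ))⁻¹ * exp (-1 / a) * 1⁻¹ := by positivity
    exact nonneg_of_mul_nonneg_left h1 h2
  have hder : ∀ t ∈ Ici x, HasDerivAt h (h' t) t := fun t ht =>
    hasDerivAt_inv_sqrt_mul_exp (hx.trans_le ht)
  have h'int : IntegrableOn h' (Ioi x) :=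
    integrableOn_Ioi_deriv_of_nonpos (hder x self_mem_Ici).continuousAt.continuousWithinAt
      (fun t ht => hder t (mem_Ici.2 (mem_Ioi.1 ht).le))
      (fun t ht => by
        have : 0 < t := hx.trans ht
        simp only [hh', hh, neg_nonpos]
        positivity)
      (tendsto_inv_sqrt_mul_exp ha)
  have h'val : ∫ t in Ioi x, h' t = 0 - h x :=
    integral_Ioi_of_hasDerivAt_of_tendsto' hder h'int (tendsto_inv_sqrt_mul_exp ha)
  have hexp : ∀ t : ℝ, exp (-t / a) = exp (-(1 / a) * t) := fun t => by ring_nf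
  have hneg : -(1 / a) < 0 := by simpa using ha
  have hEint : IntegrableOn (fun t : ℝ => (√x)⁻¹ * x⁻¹ * exp (-t / a)) (Ioi x) := by
    simp_rw [hexp]
    exact (integrableOn_exp_mul_Ioi hneg x).const_mul _
  have hEval : ∫ t in Ioi x, (√x)⁻¹ * x⁻¹ * exp (-t / a) = a * (h x * x⁻¹) := by
    rw [integral_const_mul]
    simp_rw [hh, hexp]
    rw [integral_exp_mul_Ioi hneg]
    field_simp
  have hbound : ∀ t ∈ Ioi x, ‖p t + a * c * h' t‖
      ≤ (C + a * |c| / 2) * ((√x)⁻¹ * x⁻¹ * exp (-t / a)) := fun t ht => by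
    have ht' : x < t := ht
    have ht0 : 0 < t := hx.trans ht'
    have e : p t + a * c * h' t = (p t - c * h t) - a * c / 2 * (h t * t⁻¹) := by
      simp only [hh']
      field_simp
      ring
    have hht : 0 ≤ h t * t⁻¹ := by simp only [hh]; positivity
    have hle : h t * t⁻¹ ≤ (√x)⁻¹ * x⁻¹ * exp (-t / a) := by
      have h1 : (√t)⁻¹ ≤ (√x)⁻¹ := by gcongr
      have h2 : t⁻¹ ≤ x⁻¹ := by gcongr
      calc h t * t⁻¹ = (√t)⁻¹ * t⁻¹ * exp (-t / a) := by simp only [hh]; ring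
        _ ≤ _ := by gcongr
    calc ‖p t + a * c * h' t‖ ≤ |p t - c * h t| + |a * c / 2 * (h t * t⁻¹)| := by
          rw [e]; exact abs_sub _ _
      _ ≤ C * (h t * t⁻¹) + a * |c| / 2 * (h t * t⁻¹) := by
          refine add_le_add (hpC t ht0) (le_of_eq ?_)
          rw [abs_mul, abs_of_nonneg hht, abs_div, abs_mul, abs_of_pos ha, abs_two]
      _ = (C + a * |c| / 2) * (h t * t⁻¹) := by ring
      _ ≤ _ := by gcongr
  have hbound' := (ae_restrict_iff' (μ := volume) measurableSet_Ioi).2 (ae_of_all _ hbound)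
  have hsum : IntegrableOn (fun t => p t + a * c * h' t) (Ioi x) := by
    refine Integrable.mono' (hEint.const_mul (C + a * |c| / 2)) ?_ hbound'
    exact hp.aestronglyMeasurable.add (h'int.aestronglyMeasurable.const_mul _)
  have hpint : IntegrableOn p (Ioi x) := by
    refine (Integrable.sub hsum (h'int.const_mul (a * c))).congr (ae_of_all _ fun t => ?_)
    simp
  refine ⟨hpint, ?_⟩
  have hval : (∫ t in Ioi x, p t) - a * c * h x = ∫ t in Ioi x, (p t + a * c * h' t) := by
    rw [integral_add hpint (h'int.const_mul _), integral_const_mul, h'val]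
    ring
  calc |(∫ t in Ioi x, p t) - a * c * h x|
      ≤ ∫ t in Ioi x, (C + a * |c| / 2) * ((√x)⁻¹ * x⁻¹ * exp (-t / a)) := by
        rw [hval]
        exact norm_integral_le_of_norm_le (hEint.const_mul _) hbound'
    _ = _ := by rw [integral_const_mul, hEval]; ring

lemma rpow_neg_one_div_two {x : ℝ} (hx : 0 ≤ x) : x ^ (-(1 : ℝ) / 2) = (√x)⁻¹ := by
  rw [neg_div, rpow_neg hx, sqrt_eq_rpow]

lemma isBigO_of_forall_pos_abs_le {f g : ℝ → ℝ} {C : ℝ} (h : ∀ x, 0 < x → |f x| ≤ C * g x)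
    (hg : ∀ x, 0 < x → 0 ≤ g x) : f =O[atTop] g := by
  refine IsBigO.of_bound C ?_
  filter_upwards [eventually_gt_atTop 0] with x hx
  rw [norm_eq_abs, norm_of_nonneg (hg x hx)]
  exact h x hx

/-- for a centered Gaussian vector `(ξ₁, ξ₂)` with unit variances and
correlation `ρ ∈ (−1, 1]` (realized as `(ξ₁,ξ₂) = √B η` with `η` standard Gaussian), as
`x → ∞`:
`P(ξ₁ξ₂ > x) = ((1+ρ)/√(2π)) x^{−1/2} e^{−x/(1+ρ)} (1+O(1/x))` and the density satisfies
`p_{ξ₁ξ₂}(x) = (1/√(2π)) x^{−1/2} e^{−x/(1+ρ)} (1+O(1/x))`. -/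
theorem product_two_correlated_gaussians
    (ρ : ℝ) (hρ₁ : -1 < ρ) (hρ₂ : ρ ≤ 1)
    {Ω : Type*} [MeasurableSpace Ω] (μ : Measure Ω) [IsProbabilityMeasure μ]
    (ξ₁ ξ₂ : Ω → ℝ)
    (hlaw : Measure.map (fun ω => (ξ₁ ω, ξ₂ ω)) μ
      = Measure.map (fun y : EuclideanSpace ℝ (Fin 2) =>
          ((Real.sqrt (1 + ρ) / 2 + Real.sqrt (1 - ρ) / 2) * y 0
              + (Real.sqrt (1 + ρ) / 2 - Real.sqrt (1 - ρ) / 2) * y 1,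
            (Real.sqrt (1 + ρ) / 2 - Real.sqrt (1 - ρ) / 2) * y 0
              + (Real.sqrt (1 + ρ) / 2 + Real.sqrt (1 - ρ) / 2) * y 1))
          (stdGaussian 2)) :
    ((fun x : ℝ =>
        (μ {ω | x < ξ₁ ω * ξ₂ ω}).toReal
          - ((1 + ρ) / Real.sqrt (2 * π)) * x ^ (-(1:ℝ)/2) * Real.exp (-x / (1 + ρ)))
      =O[atTop]
      fun x : ℝ => x ^ (-(1:ℝ)/2) * Real.exp (-x / (1 + ρ)) * x⁻¹) ∧
    ∃ p : ℝ → ℝ,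
      (Measure.map (fun ω => ξ₁ ω * ξ₂ ω) μ).restrict (Set.Ioi 0)
        = (volume.restrict (Set.Ioi 0)).withDensity (fun x => ENNReal.ofReal (p x)) ∧
      (fun x : ℝ =>
          p x - (Real.sqrt (2 * π))⁻¹ * x ^ (-(1:ℝ)/2) * Real.exp (-x / (1 + ρ)))
        =O[atTop]
      fun x : ℝ => x ^ (-(1:ℝ)/2) * Real.exp (-x / (1 + ρ)) * x⁻¹ := by
  have hξ : AEMeasurable (fun ω => (ξ₁ ω, ξ₂ ω)) μ := by
    by_contra hn
    rw [Measure.map_of_not_aemeasurable hn] at hlaw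
    have hS : IsProbabilityMeasure (_root_.stdGaussian 2) :=
      Measure.isProbabilityMeasure_map (by fun_prop)
    exact (Measure.isProbabilityMeasure_map (μ := _root_.stdGaussian 2) (by fun_prop)).ne_zero _
      hlaw.symm
  have ha : 0 < 1 + ρ := by linarith
  have hb : 0 ≤ 1 - ρ := by linarith
  have hmap := map_mul_eq_map_quadratic hρ₁.le hρ₂ hξ hlaw
  have hX : AEMeasurable (fun ω => ξ₁ ω * ξ₂ ω) μ := hξ.fst.mul hξ.snd
  have hdens := map_quadratic_restrict_Ioi ha hb
  rw [← hmap] at hdens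
  obtain ⟨C, hC⟩ := exists_abs_quadraticDensity_sub_le ha hb (by ring)
  have hg : ∀ x : ℝ, 0 < x → 0 ≤ x ^ (-(1 : ℝ) / 2) * exp (-x / (1 + ρ)) * x⁻¹ :=
    fun x hx => by positivity
  refine ⟨isBigO_of_forall_pos_abs_le
      (C := (C + (1 + ρ) * |(√(2 * π))⁻¹| / 2) * (1 + ρ)) (fun x hx => ?_) hg,
    quadraticDensity (1 + ρ) (1 - ρ), hdens,
    isBigO_of_forall_pos_abs_le (C := C) (fun x hx => ?_) hg⟩
  · obtain ⟨hint, hle⟩ := abs_integral_Ioi_sub_le ha (measurable_quadraticDensity _ _) hC hx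
    have htail : μ {ω | x < ξ₁ ω * ξ₂ ω}
        = ENNReal.ofReal (∫ t in Ioi x, quadraticDensity (1 + ρ) (1 - ρ) t) := by
      have hsub : Ioi x ∩ Ioi 0 = Ioi x := inter_eq_left.2 (Ioi_subset_Ioi hx.le)
      have h1 : μ {ω | x < ξ₁ ω * ξ₂ ω} = (μ.map fun ω => ξ₁ ω * ξ₂ ω) (Ioi x) :=
        (Measure.map_apply_of_aemeasurable hX measurableSet_Ioi).symm
      rw [h1, ← hsub, ← Measure.restrict_apply measurableSet_Ioi, hdens,
        withDensity_apply _ measurableSet_Ioi, Measure.restrict_restrict measurableSet_Ioi, hsub,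
        ofReal_integral_eq_lintegral_ofReal hint (ae_of_all _ (quadraticDensity_nonneg _ _))]
    rw [htail, ENNReal.toReal_ofReal (integral_nonneg (quadraticDensity_nonneg _ _)),
      rpow_neg_one_div_two hx.le]
    simpa only [div_eq_mul_inv, mul_assoc] using hle
  · rw [rpow_neg_one_div_two hx.le, mul_assoc]
    exact hC x hx
end

section
/- Let η_1, …, η_d be independent standard normal random variables, d ≥ 2. Then the product η_1 ⋯ η_d has a density p on (0,∞) satisfying p(x) = (2^{(d−1)/2}/√(2πd)) x^{1/d − 1} e^{−d x^{2/d}/2} (1 + O(x^{−2/d})) as x → ∞. -/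
open MeasureTheory ProbabilityTheory Real Filter Asymptotics Set
open scoped Topology ENNReal

theorem abs_exp_neg_sub_exp_neg_le {a b m : ℝ} (ha : exp (-a) ≤ m) (hb : exp (-b) ≤ m) :
    |exp (-a) - exp (-b)| ≤ m * |a - b| := by
  have h1 : exp (-b) * (b - a) ≤ exp (-a) - exp (-b) := by
    have : exp (-a) = exp (-b) * exp (b - a) := by rw [← exp_add]; ring_nf
    nlinarith [add_one_le_exp (b - a), exp_pos (-b)]
  have h2 : exp (-a) * (a - b) ≤ exp (-b) - exp (-a) := by
    have : exp (-b) = exp (-a) * exp (a - b) := by rw [← exp_add]; ring_nf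
    nlinarith [add_one_le_exp (a - b), exp_pos (-a)]
  have h3 : exp (-a) * |a - b| ≤ m * |a - b| := by gcongr
  have h4 : exp (-b) * |a - b| ≤ m * |a - b| := by gcongr
  rw [abs_le]
  constructor
  · nlinarith [le_abs_self (a - b), exp_pos (-b)]
  · nlinarith [neg_abs_le (a - b), exp_pos (-a)]

theorem abs_exp_neg_sub_exp_neg_add_le {a b m : ℝ} (ha : exp (-a) ≤ m) (hb : exp (-b) ≤ m) :
    |exp (-a) - exp (-b) + exp (-b) * (a - b)| ≤ m * (a - b) ^ 2 := by
  have h1 : exp (-b) * (b - a) ≤ exp (-a) - exp (-b) := by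
    have : exp (-a) = exp (-b) * exp (b - a) := by rw [← exp_add]; ring_nf
    nlinarith [add_one_le_exp (b - a), exp_pos (-b)]
  have h2 : exp (-a) * (a - b) ≤ exp (-b) - exp (-a) := by
    have : exp (-b) = exp (-a) * exp (a - b) := by rw [← exp_add]; ring_nf
    nlinarith [add_one_le_exp (a - b), exp_pos (-a)]
  rw [abs_of_nonneg (by linarith)]
  calc _ ≤ (exp (-a) - exp (-b)) * (b - a) := by linarith
    _ ≤ |exp (-a) - exp (-b)| * |a - b| := by
        rw [abs_sub_comm a b, ← abs_mul]; exact le_abs_self _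
    _ ≤ m * |a - b| * |a - b| := by
        gcongr; exact abs_exp_neg_sub_exp_neg_le ha hb
    _ = _ := by rw [mul_assoc, abs_mul_abs_self, sq]

theorem cubic_le_exp {w : ℝ} (hw : 0 ≤ w) : w + w ^ 2 + w ^ 3 ≤ 420 * exp (w / 4) := by
  have h1 := pow_div_factorial_le_exp (w / 4) (by positivity) 1
  have h2 := pow_div_factorial_le_exp (w / 4) (by positivity) 2
  have h3 := pow_div_factorial_le_exp (w / 4) (by positivity) 3
  norm_num [Nat.factorial] at h1 h2 h3
  nlinarith [exp_pos (w / 4)]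

theorem exp_mul_abs_le (K u : ℝ) : exp (K * |u|) ≤ exp (K ^ 2) * exp (u ^ 2 / 4) := by
  rw [← exp_add, exp_le_exp]
  nlinarith [sq_nonneg (K - |u| / 2), sq_abs u]

theorem exp_neg_phase_mul_sub_le {ψ g : ℝ → ℝ} {k α β M : ℝ} (hk : 1 ≤ k) (hM : 0 ≤ M)
    (hψ : ∀ u, u ^ 2 ≤ ψ u)
    (hψ' : ∀ u, |ψ u - k * u ^ 2 - β * u ^ 3| ≤ M * u ^ 4 * exp (M * |u|))
    (hg : ∀ u, |g u - 1 - α * u| ≤ M * u ^ 2 * exp (M * |u|)) :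
    ∃ C, 0 ≤ C ∧ ∀ t u : ℝ, 1 ≤ t →
      |exp (-(t * ψ u)) * g u - exp (-(t * (k * u ^ 2))) * (1 + (α * u - t * β * u ^ 3))| ≤
        C / t * exp (-(t / 2) * u ^ 2) := by
  set N := |β| + M with hN
  have hN0 : 0 ≤ N := by positivity
  refine ⟨(M + |α| * N + N ^ 2) * (exp ((2 * (M + 1)) ^ 2) * 420), by positivity, fun t u ht => ?_⟩
  have ht0 : 0 < t := by linarith
  set E := exp (-(t * ψ u)) with hE
  set G := exp (-(t * (k * u ^ 2))) with hG
  set m := exp (-(t * u ^ 2)) with hm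
  set Y := exp (2 * (M + 1) * |u|) with hY
  set ρ := t * ψ u - t * (k * u ^ 2) with hρ
  have hm0 : 0 < m := exp_pos _
  have hY0 : 0 < Y := exp_pos _
  have hEm : E ≤ m := by
    rw [hE, hm, exp_le_exp]; nlinarith [hψ u]
  have hGm : G ≤ m := by
    rw [hG, hm, exp_le_exp]
    have : u ^ 2 ≤ k * u ^ 2 := by nlinarith [sq_nonneg u]
    nlinarith
  have hu := abs_nonneg u
  have hX : exp (M * |u|) ≤ Y := by
    rw [hY, exp_le_exp]; nlinarith
  have hX1 : exp ((M + 1) * |u|) ≤ Y := by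
    rw [hY, exp_le_exp]; nlinarith
  have hXX : exp ((M + 1) * |u|) ^ 2 = Y := by
    rw [hY, ← exp_nat_mul]; congr 1; push_cast; ring
  have hX2 : |u| * exp (M * |u|) ≤ exp ((M + 1) * |u|) := by
    rw [add_mul, one_mul, add_comm, exp_add]
    gcongr
    linarith [add_one_le_exp |u|]
  have hone : 1 ≤ exp ((M + 1) * |u|) := one_le_exp (by positivity)
  have hR1 : |ρ - t * β * u ^ 3| ≤ t * (M * u ^ 4 * exp (M * |u|)) := by
    have : ρ - t * β * u ^ 3 = t * (ψ u - k * u ^ 2 - β * u ^ 3) := by rw [hρ]; ring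
    rw [this, abs_mul, abs_of_pos ht0]
    gcongr
    exact hψ' u
  have hR : |ρ| ≤ t * |u| ^ 3 * N * exp ((M + 1) * |u|) := by
    calc |ρ| = |(ρ - t * β * u ^ 3) + t * β * u ^ 3| := by ring_nf
      _ ≤ t * (M * u ^ 4 * exp (M * |u|)) + t * |β| * |u| ^ 3 := by
        refine (abs_add_le _ _).trans ?_
        rw [abs_mul (t * β), abs_mul t, abs_of_pos ht0, abs_pow]
        gcongr
      _ = t * |u| ^ 3 * (M * (|u| * exp (M * |u|)) + |β| * 1) := by
        rw [← Even.pow_abs (by decide : Even 4) u]; ring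
      _ ≤ t * |u| ^ 3 * (M * exp ((M + 1) * |u|) + |β| * exp ((M + 1) * |u|)) := by gcongr
      _ = _ := by rw [hN]; ring
  have hEG := abs_exp_neg_sub_exp_neg_le hEm hGm
  have hEG2 := abs_exp_neg_sub_exp_neg_add_le hEm hGm
  rw [← hE, ← hG, ← hρ] at hEG hEG2
  have e4 : |u| * |u| ^ 3 = u ^ 4 := by rw [← Even.pow_abs (by decide : Even 4) u]; ring
  have e6 : (|u| ^ 3) ^ 2 = u ^ 6 := by rw [← Even.pow_abs (by decide : Even 6) u]; ring
  have b1 : |E * (g u - 1 - α * u)| ≤ m * (M * u ^ 2 * Y) := by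
    rw [abs_mul, abs_of_pos (exp_pos _)]
    gcongr
    exact (hg u).trans (by gcongr)
  have b2 : |(E - G) * (α * u)| ≤ m * (t * |α| * N * u ^ 4 * Y) := by
    rw [abs_mul, abs_mul]
    calc _ ≤ (m * (t * |u| ^ 3 * N * Y)) * (|α| * |u|) := by
          gcongr
          refine hEG.trans ?_
          gcongr
          exact hR.trans (by gcongr)
      _ = _ := by rw [← e4]; ring
  have b3 : |E - G + G * ρ| ≤ m * (t ^ 2 * N ^ 2 * u ^ 6 * Y) := by
    refine hEG2.trans ?_
    gcongr
    rw [← sq_abs]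
    calc _ ≤ (t * |u| ^ 3 * N * exp ((M + 1) * |u|)) ^ 2 := by gcongr
      _ = _ := by rw [← e6, ← hXX]; ring
  have b4 : |G * (ρ - t * β * u ^ 3)| ≤ m * (t * M * u ^ 4 * Y) := by
    rw [abs_mul, abs_of_pos (exp_pos _)]
    calc _ ≤ m * (t * (M * u ^ 4 * Y)) := by
          gcongr
          exact hR1.trans (by gcongr)
      _ = _ := by ring
  have hsum : |E * g u - G * (1 + (α * u - t * β * u ^ 3))| ≤
      m * Y * (M * u ^ 2 + t * |α| * N * u ^ 4 + t ^ 2 * N ^ 2 * u ^ 6 + t * M * u ^ 4) := by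
    calc _ = |E * (g u - 1 - α * u) + (E - G) * (α * u) + (E - G + G * ρ)
            - G * (ρ - t * β * u ^ 3)| := by congr 1; ring
      _ ≤ |E * (g u - 1 - α * u)| + |(E - G) * (α * u)| + |E - G + G * ρ|
            + |G * (ρ - t * β * u ^ 3)| := by
          refine (abs_sub _ _).trans ?_
          gcongr
          exact abs_add_three _ _ _
      _ ≤ _ := by linarith
  refine hsum.trans ?_
  set w := t * u ^ 2 with hw
  have hw0 : 0 ≤ w := by positivity
  have hYw : Y ≤ exp ((2 * (M + 1)) ^ 2) * exp (w / 4) := by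
    refine (exp_mul_abs_le (2 * (M + 1)) u).trans ?_
    gcongr
    nlinarith [sq_nonneg u]
  have hme : m * exp (w / 4) * exp (w / 4) = exp (-(t / 2) * u ^ 2) := by
    rw [hm, ← exp_add, ← exp_add, hw]; congr 1; ring
  have hpoly : M * u ^ 2 + t * |α| * N * u ^ 4 + t ^ 2 * N ^ 2 * u ^ 6 + t * M * u ^ 4 ≤
      (M + |α| * N + N ^ 2) / t * (w + w ^ 2 + w ^ 3) := by
    have : (M + |α| * N + N ^ 2) / t * (w + w ^ 2 + w ^ 3) =
      (M + |α| * N + N ^ 2) * (u ^ 2 + t * u ^ 4 + t ^ 2 * u ^ 6) := by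
        rw [hw]; field_simp
    rw [this]
    have i1 : 0 ≤ |α| * N * u ^ 2 := by positivity
    have i2 : 0 ≤ N ^ 2 * u ^ 2 := by positivity
    have i3 : 0 ≤ N ^ 2 * (t * u ^ 4) := by positivity
    have i4 : 0 ≤ (M + |α| * N) * (t ^ 2 * u ^ 6) := by positivity
    linarith
  calc _ ≤ m * (exp ((2 * (M + 1)) ^ 2) * exp (w / 4)) *
        ((M + |α| * N + N ^ 2) / t * (420 * exp (w / 4))) := by
        gcongr
        exact hpoly.trans (by gcongr; exact cubic_le_exp hw0)
    _ = _ := by rw [← hme]; ring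

theorem norm_exp_neg_mul_le {ψ h : ℝ → ℝ} {B K t u : ℝ} (ht : 0 < t) (hB : 0 ≤ B)
    (hψ : u ^ 2 ≤ ψ u) (hh : |h u| ≤ B * exp (K * |u|)) :
    ‖exp (-(t * ψ u)) * h u‖ ≤ B * exp (K ^ 2 / t) * exp (-(t / 2) * u ^ 2) := by
  rw [norm_mul, norm_eq_abs, norm_eq_abs, abs_of_pos (exp_pos _)]
  calc _ ≤ exp (-(t * u ^ 2)) * (B * exp (K * |u|)) := by gcongr
    _ = B * exp (-(t * u ^ 2) + K * |u|) := by rw [exp_add]; ring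
    _ ≤ B * exp (K ^ 2 / t + -(t / 2) * u ^ 2) := by
      refine mul_le_mul_of_nonneg_left (exp_le_exp.2 ?_) hB
      have h1 : 0 ≤ (K / t - |u| / 2) ^ 2 * t := by positivity
      have h2 : (K / t - |u| / 2) ^ 2 * t = K ^ 2 / t - K * |u| + t * u ^ 2 / 4 := by
        rw [← sq_abs u]; field_simp; ring
      have h3 : 0 ≤ t * u ^ 2 := by positivity
      linarith
    _ = _ := by rw [exp_add]; ring

theorem integrable_exp_neg_mul {ψ h : ℝ → ℝ} {B K t : ℝ} (ht : 0 < t) (hB : 0 ≤ B)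
    (hψm : Measurable ψ) (hhm : Measurable h)
    (hψ : ∀ u, u ^ 2 ≤ ψ u) (hh : ∀ u, |h u| ≤ B * exp (K * |u|)) :
    Integrable fun u => exp (-(t * ψ u)) * h u := by
  refine ((integrable_exp_neg_mul_sq (half_pos ht)).const_mul (B * exp (K ^ 2 / t))).mono'
    (by fun_prop) (ae_of_all _ fun u => norm_exp_neg_mul_le ht hB (hψ u) (hh u))

theorem sqrt_pi_div_half_sq {r : ℝ} (hr : 0 < r) : r * √(π / (r ^ 2 / 2)) = √(2 * π) := by
  have : π / (r ^ 2 / 2) = 2 * π / r ^ 2 := by field_simp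
  rw [this, sqrt_div' _ (by positivity), sqrt_sq hr.le]
  field_simp

theorem abs_integral_exp_neg_mul_le {ψ h : ℝ → ℝ} {B K r : ℝ} (hr : 1 ≤ r) (hB : 0 ≤ B)
    (hψ : ∀ u, u ^ 2 ≤ ψ u) (hh : ∀ u, |h u| ≤ B * exp (K * |u|)) :
    r * |∫ u, exp (-(r ^ 2 * ψ u)) * h u| ≤ B * exp (K ^ 2) * √(2 * π) := by
  have hr0 : 0 < r := by linarith
  have hr2 : 1 ≤ r ^ 2 := one_le_pow₀ hr
  have hle : |∫ u, exp (-(r ^ 2 * ψ u)) * h u| ≤ B * exp (K ^ 2) * √(π / (r ^ 2 / 2)) := by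
    rw [← integral_gaussian, ← integral_const_mul]
    refine norm_integral_le_of_norm_le
      ((integrable_exp_neg_mul_sq (by positivity)).const_mul _)
      (ae_of_all _ fun u => (norm_exp_neg_mul_le (by positivity) hB (hψ u) (hh u)).trans ?_)
    gcongr
    exact div_le_self (sq_nonneg K) hr2
  calc _ ≤ r * (B * exp (K ^ 2) * √(π / (r ^ 2 / 2))) := by gcongr
    _ = _ := by rw [← sqrt_pi_div_half_sq hr0]; ring

theorem integral_eq_zero_of_odd {f : ℝ → ℝ} (hf : ∀ x, f (-x) = -f x) : ∫ x, f x = 0 := by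
  have h := integral_neg_eq_self f volume
  simp only [hf, integral_neg] at h
  linarith

theorem laplace_quadratic_minimum {ψ g : ℝ → ℝ} {k α β M : ℝ} (hk : 1 ≤ k) (hM : 0 ≤ M)
    (hψm : Measurable ψ) (hgm : Measurable g) (hψ : ∀ u, u ^ 2 ≤ ψ u)
    (hψ' : ∀ u, |ψ u - k * u ^ 2 - β * u ^ 3| ≤ M * u ^ 4 * exp (M * |u|))
    (hg : ∀ u, |g u - 1 - α * u| ≤ M * u ^ 2 * exp (M * |u|))
    (hgb : ∀ u, |g u| ≤ exp (M * |u|)) :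
    ∃ C, 0 ≤ C ∧ ∀ r : ℝ, 1 ≤ r →
      |√(k / π) * (r * ∫ u, exp (-(r ^ 2 * ψ u)) * g u) - 1| ≤ C / r ^ 2 := by
  obtain ⟨C, hC, H⟩ := exp_neg_phase_mul_sub_le hk hM hψ hψ' hg
  refine ⟨√(k / π) * (C * √(2 * π)), by positivity, fun r hr => ?_⟩
  have hr0 : 0 < r := by linarith
  have hk0 : 0 < k := by linarith
  have hb : 0 < r ^ 2 * k := by positivity
  have hint1 : Integrable fun u => exp (-(r ^ 2 * ψ u)) * g u :=
    integrable_exp_neg_mul (B := 1) (K := M) (by positivity) zero_le_one hψm hgm hψ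
      (by simpa using hgb)
  have hG0 : Integrable fun u : ℝ => exp (-(r ^ 2 * (k * u ^ 2))) := by
    simpa [mul_assoc] using integrable_exp_neg_mul_sq hb
  have hG1 : Integrable fun u : ℝ => exp (-(r ^ 2 * (k * u ^ 2))) * u := by
    refine (integrable_mul_exp_neg_mul_sq hb).congr (ae_of_all _ fun u => ?_)
    dsimp only
    rw [mul_comm]; congr 2; ring
  have hG3 : Integrable fun u : ℝ => exp (-(r ^ 2 * (k * u ^ 2))) * u ^ 3 := by
    have := integrable_rpow_mul_exp_neg_mul_sq hb (s := 3) (by norm_num)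
    refine this.congr (ae_of_all _ fun u => ?_)
    have h3 : u ^ (3 : ℝ) = u ^ 3 := by exact_mod_cast rpow_natCast u 3
    simp only [h3]
    rw [mul_comm]; congr 2; ring
  have hodd : Integrable fun u : ℝ =>
      exp (-(r ^ 2 * (k * u ^ 2))) * (α * u - r ^ 2 * β * u ^ 3) := by
    refine ((hG1.const_mul α).sub (hG3.const_mul (r ^ 2 * β))).congr (ae_of_all _ fun u => ?_)
    simp only [Pi.sub_apply]; ring
  have hint2 : Integrable fun u : ℝ =>
      exp (-(r ^ 2 * (k * u ^ 2))) * (1 + (α * u - r ^ 2 * β * u ^ 3)) := by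
    simp only [mul_add _ (1 : ℝ), mul_one]
    exact hG0.add hodd
  have hval : ∫ u : ℝ, exp (-(r ^ 2 * (k * u ^ 2))) * (1 + (α * u - r ^ 2 * β * u ^ 3)) =
      √(π / (r ^ 2 * k)) := by
    simp only [mul_add _ (1 : ℝ), mul_one]
    rw [integral_add hG0 hodd, integral_eq_zero_of_odd (f := fun u : ℝ =>
      exp (-(r ^ 2 * (k * u ^ 2))) * (α * u - r ^ 2 * β * u ^ 3)) (fun x => by ring_nf),
      add_zero, ← integral_gaussian]
    congr 1; ext u; congr 1; ring
  have hnorm : √(k / π) * (r * √(π / (r ^ 2 * k))) = 1 := by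
    have hs : √(π / (r ^ 2 * k)) = (√(k / π))⁻¹ / r := by
      have : π / (r ^ 2 * k) = (k / π)⁻¹ / r ^ 2 := by field_simp
      rw [this, sqrt_div' _ (by positivity), sqrt_sq hr0.le, sqrt_inv]
    rw [hs]
    have : √(k / π) ≠ 0 := by positivity
    field_simp
  have hdiff : |∫ u, (exp (-(r ^ 2 * ψ u)) * g u -
      exp (-(r ^ 2 * (k * u ^ 2))) * (1 + (α * u - r ^ 2 * β * u ^ 3)))| ≤
      C / r ^ 2 * √(π / (r ^ 2 / 2)) := by
    rw [← norm_eq_abs, ← integral_gaussian (r ^ 2 / 2), ← integral_const_mul]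
    refine norm_integral_le_of_norm_le
      ((integrable_exp_neg_mul_sq (by positivity)).const_mul _) (ae_of_all _ fun u => ?_)
    exact H (r ^ 2) u (one_le_pow₀ hr)
  rw [integral_sub hint1 hint2, hval] at hdiff
  calc _ = |√(k / π) * (r * ((∫ u, exp (-(r ^ 2 * ψ u)) * g u) - √(π / (r ^ 2 * k))))| := by
        rw [mul_sub, mul_sub, hnorm]
    _ = √(k / π) * (r * |(∫ u, exp (-(r ^ 2 * ψ u)) * g u) - √(π / (r ^ 2 * k))|) := by
        rw [abs_mul, abs_mul, abs_of_nonneg (sqrt_nonneg _), abs_of_pos hr0]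
    _ ≤ √(k / π) * (r * (C / r ^ 2 * √(π / (r ^ 2 / 2)))) := by gcongr
    _ = _ := by rw [← sqrt_pi_div_half_sq hr0]; ring

/-- Up to the factor `r ^ 2`, the exponent of the integrand of the multiplicative convolution of
the density of the product of `D` Gaussians with one more Gaussian, in logarithmic coordinates
centred at the saddle point. -/
noncomputable def phase (D u : ℝ) : ℝ := (exp (2 * D * u) + D * exp (-2 * u) - (D + 1)) / 2

@[fun_prop]
theorem measurable_phase (D : ℝ) : Measurable (phase D) := by
  unfold phase; fun_prop

theorem sq_le_phase {D : ℝ} (hD : 1 ≤ D) (u : ℝ) : u ^ 2 ≤ phase D u := by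
  unfold phase
  rcases le_total 0 u with hu | hu
  · have h1 := quadratic_le_exp_of_nonneg (x := 2 * D * u) (by positivity)
    have h2 := add_one_le_exp (-2 * u)
    have h3 : u ^ 2 ≤ D ^ 2 * u ^ 2 := by nlinarith [sq_nonneg u, one_le_pow₀ (n := 2) hD]
    nlinarith
  · have h1 := quadratic_le_exp_of_nonneg (x := -2 * u) (by linarith)
    have h2 := add_one_le_exp (2 * D * u)
    have h3 : u ^ 2 ≤ D * u ^ 2 := by nlinarith [sq_nonneg u]
    nlinarith

theorem abs_exp_sub_cubic_le (x : ℝ) :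
    |exp x - (1 + x + x ^ 2 / 2 + x ^ 3 / 6)| ≤ x ^ 4 * exp |x| := by
  have h := Complex.norm_exp_sub_sum_le_norm_mul_exp x 4
  norm_num [Finset.sum_range_succ, Nat.factorial] at h
  have e : Complex.exp x - (1 + x + (x : ℂ) ^ 2 / 2 + (x : ℂ) ^ 3 / 6) =
      ((exp x - (1 + x + x ^ 2 / 2 + x ^ 3 / 6) : ℝ) : ℂ) := by push_cast; ring
  rw [e, Complex.norm_real, norm_eq_abs, Even.pow_abs (by decide)] at h
  exact h

theorem abs_exp_sub_linear_le (x : ℝ) : |exp x - 1 - x| ≤ x ^ 2 * exp |x| := by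
  have h := Complex.norm_exp_sub_sum_le_norm_mul_exp x 2
  norm_num [Finset.sum_range_succ, Nat.factorial] at h
  have e : Complex.exp x - (1 + x) = ((exp x - 1 - x : ℝ) : ℂ) := by push_cast; ring
  rwa [e, Complex.norm_real, norm_eq_abs] at h

theorem abs_phase_sub_cubic_le {D : ℝ} (hD : 1 ≤ D) (u : ℝ) :
    |phase D u - D * (D + 1) * u ^ 2 - (2 / 3 * (D ^ 3 - D)) * u ^ 3| ≤
      16 * D ^ 4 * u ^ 4 * exp (16 * D ^ 4 * |u|) := by
  have h1 := abs_exp_sub_cubic_le (2 * D * u)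
  have h2 := abs_exp_sub_cubic_le (-2 * u)
  have hD0 : 0 < D := by linarith
  have hD4 : D ≤ D ^ 4 := le_self_pow₀ hD (by norm_num)
  have hX1 : exp |2 * D * u| ≤ exp (16 * D ^ 4 * |u|) := by
    rw [exp_le_exp, abs_mul, abs_of_pos (by positivity : 0 < 2 * D)]
    gcongr; linarith
  have hX2 : exp |-2 * u| ≤ exp (16 * D ^ 4 * |u|) := by
    rw [exp_le_exp, abs_mul]
    gcongr; norm_num; linarith
  have e : phase D u - D * (D + 1) * u ^ 2 - (2 / 3 * (D ^ 3 - D)) * u ^ 3 =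
      1 / 2 * (exp (2 * D * u) - (1 + (2 * D * u) + (2 * D * u) ^ 2 / 2 + (2 * D * u) ^ 3 / 6)) +
      D / 2 * (exp (-2 * u) - (1 + (-2 * u) + (-2 * u) ^ 2 / 2 + (-2 * u) ^ 3 / 6)) := by
    unfold phase; ring
  rw [e]
  refine (abs_add_le _ _).trans ?_
  rw [abs_mul, abs_mul, abs_of_pos (by norm_num : (0 : ℝ) < 1 / 2),
    abs_of_pos (by positivity : 0 < D / 2)]
  calc _ ≤ 1 / 2 * ((2 * D * u) ^ 4 * exp (16 * D ^ 4 * |u|)) +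
        D / 2 * ((-2 * u) ^ 4 * exp (16 * D ^ 4 * |u|)) := by
        gcongr
        · exact h1.trans (by gcongr)
        · exact h2.trans (by gcongr)
    _ = (8 * D ^ 4 + 8 * D) * (u ^ 4 * exp (16 * D ^ 4 * |u|)) := by ring
    _ ≤ (16 * D ^ 4) * (u ^ 4 * exp (16 * D ^ 4 * |u|)) := by gcongr; linarith
    _ = _ := by ring

theorem mul_exp_neg_sq_le (z : ℝ) : z * exp (-(z ^ 2 / 2)) ≤ 1 := by
  have h : z ≤ exp (z ^ 2 / 2) := by
    nlinarith [add_one_le_exp (z ^ 2 / 2), sq_nonneg (z - 1)]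
  calc _ ≤ exp (z ^ 2 / 2) * exp (-(z ^ 2 / 2)) := by gcongr
    _ = 1 := by rw [← exp_add]; simp

theorem mul_exp_neg_phase_le (n : ℕ) {r : ℝ} (hr : 0 < r) (hr1 : r ≤ 1) (u : ℝ) :
    r * (exp (-(r ^ 2 * phase (n + 1) u)) * exp (n * u)) ≤
      exp ((n + 2) / 2) * exp (-|u|) := by
  have hn : (0 : ℝ) ≤ n := n.cast_nonneg
  have hr2 : r ^ 2 ≤ 1 := pow_le_one₀ hr.le hr1
  set z := r * exp ((n + 1) * u) with hz
  set y := r * exp (-u) with hy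
  have hz2 : z ^ 2 = r ^ 2 * exp (2 * (n + 1) * u) := by
    rw [hz, mul_pow, ← exp_nat_mul]; congr 2; push_cast; ring
  have hy2 : y ^ 2 = r ^ 2 * exp (-2 * u) := by
    rw [hy, mul_pow, ← exp_nat_mul]; congr 2; push_cast; ring
  have hy20 := sq_nonneg y
  have hz20 := sq_nonneg z
  have hE : ∀ s, s ≤ z ^ 2 ∨ s ≤ y ^ 2 →
      exp (-(r ^ 2 * phase (n + 1) u)) ≤ exp ((n + 2) / 2) * exp (-(s / 2)) := by
    intro s hs
    rw [← exp_add, exp_le_exp]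
    have : r ^ 2 * phase (n + 1) u = (z ^ 2 + (n + 1) * y ^ 2 - (n + 2) * r ^ 2) / 2 := by
      rw [hz2, hy2, phase]; ring
    rw [this]
    rcases hs with hs | hs <;> nlinarith
  rcases le_total 0 u with hu | hu
  · rw [abs_of_nonneg hu]
    have e : r * exp (n * u) = z * exp (-u) := by
      rw [hz, mul_assoc, ← exp_add]; congr 2; ring
    calc _ = (z * exp (-u)) * exp (-(r ^ 2 * phase (n + 1) u)) := by rw [← e]; ring
      _ ≤ (z * exp (-u)) * (exp ((n + 2) / 2) * exp (-(z ^ 2 / 2))) := by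
        gcongr; exact hE _ (Or.inl le_rfl)
      _ = exp ((n + 2) / 2) * exp (-u) * (z * exp (-(z ^ 2 / 2))) := by ring
      _ ≤ exp ((n + 2) / 2) * exp (-u) * 1 := by gcongr; exact mul_exp_neg_sq_le z
      _ = _ := mul_one _
  · rw [abs_of_nonpos hu, neg_neg]
    have e : r * exp (n * u) = y * exp ((n + 1) * u) := by
      rw [hy, mul_assoc, ← exp_add]; congr 2; ring
    calc _ = (y * exp ((n + 1) * u)) * exp (-(r ^ 2 * phase (n + 1) u)) := by rw [← e]; ring
      _ ≤ (y * exp ((n + 1) * u)) * (exp ((n + 2) / 2) * exp (-(y ^ 2 / 2))) := by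
        gcongr; exact hE _ (Or.inr le_rfl)
      _ = exp ((n + 2) / 2) * exp ((n + 1) * u) * (y * exp (-(y ^ 2 / 2))) := by ring
      _ ≤ exp ((n + 2) / 2) * exp u * 1 := by
        gcongr
        · nlinarith
        · exact mul_exp_neg_sq_le y
      _ = _ := mul_one _

/-- The density of the product of `n + 1` Gaussians at `r ^ (n + 1)`, relative to its asymptotic
form. -/
noncomputable def densityRatio : ℕ → ℝ → ℝ
  | 0, _ => 1
  | n + 1, r => √((n + 1) * (n + 2) / π) *
      (r * ∫ u, exp (-(r ^ 2 * phase (n + 1) u)) * (exp (n * u) * densityRatio n (r * exp (-u))))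

theorem measurable_densityRatio (n : ℕ) : Measurable (densityRatio n) := by
  induction n with
  | zero => exact measurable_const
  | succ n ih =>
    have h : StronglyMeasurable fun p : ℝ × ℝ =>
        exp (-(p.1 ^ 2 * phase (n + 1) p.2)) * (exp (n * p.2) * densityRatio n (p.1 * exp (-p.2))) := by
      refine Measurable.stronglyMeasurable ?_
      have h1 : Measurable fun p : ℝ × ℝ => densityRatio n (p.1 * exp (-p.2)) :=
        ih.comp (by fun_prop)
      fun_prop
    have := (h.integral_prod_right' (ν := volume)).measurable
    exact (measurable_id.mul this).const_mul _

theorem densityRatio_nonneg (n : ℕ) : ∀ r : ℝ, 0 < r → 0 ≤ densityRatio n r := by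
  induction n with
  | zero => exact fun r _ => zero_le_one
  | succ n ih =>
    intro r hr
    refine mul_nonneg (sqrt_nonneg _) (mul_nonneg hr.le (integral_nonneg fun u => ?_))
    have := ih (r * exp (-u)) (by positivity)
    positivity

theorem integrable_exp_neg_abs : Integrable fun u : ℝ => exp (-|u|) := by
  rw [← integrableOn_univ, ← Iic_union_Ioi (a := (0 : ℝ))]
  refine IntegrableOn.union ?_ ?_
  · exact (integrableOn_exp_Iic 0).congr_fun
      (fun u (hu : u ≤ 0) => by simp only [abs_of_nonpos hu, neg_neg]) measurableSet_Iic
  · exact (integrableOn_exp_neg_Ioi 0).congr_fun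
      (fun u (hu : 0 < u) => by simp only [abs_of_pos hu]) measurableSet_Ioi

theorem exp_mul_le_exp_mul_abs {a b : ℝ} (hab : |a| ≤ b) (u : ℝ) :
    exp (a * u) ≤ exp (b * |u|) := by
  rw [exp_le_exp]
  calc a * u ≤ |a * u| := le_abs_self _
    _ ≤ _ := by rw [abs_mul]; gcongr

theorem integrable_densityRatio_integrand (n : ℕ) {r C : ℝ} (hr : 0 < r)
    (hC : ∀ r, 0 < r → |densityRatio n r| ≤ C) :
    Integrable fun u =>
      exp (-(r ^ 2 * phase (n + 1) u)) * (exp (n * u) * densityRatio n (r * exp (-u))) := by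
  have hn : (0 : ℝ) ≤ n := n.cast_nonneg
  have hC0 : 0 ≤ C := (abs_nonneg _).trans (hC 1 one_pos)
  have hm : Measurable fun u => densityRatio n (r * exp (-u)) :=
    (measurable_densityRatio n).comp (by fun_prop)
  refine integrable_exp_neg_mul (B := C) (K := n) (by positivity) hC0 (by fun_prop) (by fun_prop)
    (sq_le_phase (by linarith)) fun u => ?_
  rw [abs_mul, abs_of_pos (exp_pos _), mul_comm]
  gcongr
  · exact hC _ (by positivity)
  · exact le_abs_self u

theorem exists_abs_densityRatio_sub_one_le (n : ℕ) :
    ∃ C, 0 ≤ C ∧ ∀ r, 0 < r → |densityRatio n r - 1| ≤ C ∧ |densityRatio n r - 1| ≤ C / r ^ 2 := by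
  induction n with
  | zero => exact ⟨0, le_rfl, fun r _ => by simp [densityRatio]⟩
  | succ n ih =>
    obtain ⟨C, hC, ih⟩ := ih
    have hn : (0 : ℝ) ≤ n := n.cast_nonneg
    have hD : (1 : ℝ) ≤ n + 1 := by linarith
    have hb : ∀ r, 0 < r → |densityRatio n r| ≤ 1 + C := fun r hr => by
      calc |densityRatio n r| = |1 + (densityRatio n r - 1)| := by ring_nf
        _ ≤ |1| + |densityRatio n r - 1| := abs_add_le _ _
        _ ≤ _ := by rw [abs_one]; gcongr; exact (ih r hr).1
    set s := √(((n : ℝ) + 1) * (n + 2) / π) with hs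
    have hs0 : 0 ≤ s := sqrt_nonneg _
    set M : ℝ := 16 * (n + 1) ^ 4 with hM
    have hpow : (n : ℝ) + 1 ≤ (n + 1) ^ 4 := le_self_pow₀ hD (by norm_num)
    have hpow2 : (n : ℝ) ^ 2 ≤ (n + 1) ^ 4 := by
      calc (n : ℝ) ^ 2 ≤ (n + 1) ^ 2 := by gcongr; linarith
        _ ≤ _ := pow_le_pow_right₀ hD (by norm_num)
    obtain ⟨L, hL, hlap⟩ := laplace_quadratic_minimum (ψ := phase (n + 1))
      (g := fun u => exp (n * u)) (k := (n + 1) * (n + 2)) (α := n) (M := M)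
      (β := 2 / 3 * ((n + 1) ^ 3 - (n + 1))) (by nlinarith) (by positivity)
      (by fun_prop) (by fun_prop) (sq_le_phase hD)
      (fun u => by
        have := abs_phase_sub_cubic_le hD u
        rwa [show (n : ℝ) + 1 + 1 = n + 2 by ring] at this)
      (fun u => by
        refine (abs_exp_sub_linear_le (n * u)).trans ?_
        rw [mul_pow, abs_mul, abs_of_nonneg hn]
        gcongr
        · linarith
        · linarith)
      (fun u => by
        rw [abs_of_pos (exp_pos _)]
        exact exp_mul_le_exp_mul_abs (by rw [abs_of_nonneg hn]; linarith) u)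
    set A := L + s * (C * exp (((n : ℝ) + 2) ^ 2) * √(2 * π)) with hA
    set B := s * ((1 + C) * exp ((n + 2) / 2) * ∫ u, exp (-|u|)) + 1 with hB
    have hA0 : 0 ≤ A := by positivity
    have hB0 : 0 ≤ B := by positivity
    have hlarge : ∀ r : ℝ, 1 ≤ r → |densityRatio (n + 1) r - 1| ≤ A / r ^ 2 := by
      intro r hr
      have hr0 : 0 < r := by linarith
      have hint0 : Integrable fun u => exp (-(r ^ 2 * phase (n + 1) u)) * exp (n * u) :=
        integrable_exp_neg_mul (B := 1) (K := n) (by positivity) zero_le_one (by fun_prop)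
          (by fun_prop) (sq_le_phase hD) fun u => by
            rw [abs_of_pos (exp_pos _), one_mul]
            exact exp_mul_le_exp_mul_abs (abs_of_nonneg hn).le u
      have hint := integrable_densityRatio_integrand n hr0 hb
      have herr := abs_integral_exp_neg_mul_le (ψ := phase (n + 1)) (B := C / r ^ 2)
        (K := (n : ℝ) + 2) hr (by positivity) (sq_le_phase hD)
        (h := fun u => exp (n * u) * (densityRatio n (r * exp (-u)) - 1)) fun u => by
          rw [abs_mul, abs_of_pos (exp_pos _)]
          calc _ ≤ exp (n * u) * (C / (r * exp (-u)) ^ 2) := by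
                gcongr; exact (ih _ (by positivity)).2
            _ = C / r ^ 2 * exp ((n + 2) * u) := by
                have : exp ((n + 2) * u) = exp (n * u) / exp (-u) ^ 2 := by
                  rw [← exp_nat_mul, ← exp_sub]; congr 1; push_cast; ring
                rw [this]; field_simp
            _ ≤ _ := by
                refine mul_le_mul_of_nonneg_left ?_ (by positivity)
                exact exp_mul_le_exp_mul_abs (abs_of_nonneg (by positivity)).le u
      have hsplit : ∫ u, exp (-(r ^ 2 * phase (n + 1) u)) *
          (exp (n * u) * (densityRatio n (r * exp (-u)) - 1)) =
          (∫ u, exp (-(r ^ 2 * phase (n + 1) u)) * (exp (n * u) * densityRatio n (r * exp (-u)))) -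
          ∫ u, exp (-(r ^ 2 * phase (n + 1) u)) * exp (n * u) := by
        rw [← integral_sub hint hint0]
        congr 1; ext u; ring
      calc |densityRatio (n + 1) r - 1|
          = |(s * (r * ∫ u, exp (-(r ^ 2 * phase (n + 1) u)) * exp (n * u)) - 1) +
            s * (r * ∫ u, exp (-(r ^ 2 * phase (n + 1) u)) *
              (exp (n * u) * (densityRatio n (r * exp (-u)) - 1)))| := by
            rw [hsplit, densityRatio, ← hs]; congr 1; ring
        _ ≤ L / r ^ 2 + s * (C / r ^ 2 * exp ((n + 2) ^ 2) * √(2 * π)) := by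
            refine (abs_add_le _ _).trans (add_le_add (hlap r hr) ?_)
            rw [abs_mul, abs_mul, abs_of_nonneg hs0, abs_of_pos hr0]
            gcongr
        _ = A / r ^ 2 := by rw [hA]; ring
    have hsmall : ∀ r : ℝ, 0 < r → r ≤ 1 → |densityRatio (n + 1) r - 1| ≤ B := by
      intro r hr hr1
      have hle : |r * ∫ u, exp (-(r ^ 2 * phase (n + 1) u)) *
          (exp (n * u) * densityRatio n (r * exp (-u)))| ≤
          (1 + C) * exp ((n + 2) / 2) * ∫ u, exp (-|u|) := by
        rw [← norm_eq_abs, ← integral_const_mul, ← integral_const_mul]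
        refine norm_integral_le_of_norm_le (integrable_exp_neg_abs.const_mul _)
          (ae_of_all _ fun u => ?_)
        rw [norm_eq_abs]
        calc _ = r * (exp (-(r ^ 2 * phase (n + 1) u)) * exp (n * u)) *
              |densityRatio n (r * exp (-u))| := by
              rw [abs_mul, abs_mul, abs_mul, abs_of_pos hr, abs_of_pos (exp_pos _),
                abs_of_pos (exp_pos _)]
              ring
          _ ≤ (exp ((n + 2) / 2) * exp (-|u|)) * (1 + C) := by
              exact mul_le_mul (mul_exp_neg_phase_le n hr hr1 u) (hb _ (by positivity))
                (abs_nonneg _) (by positivity)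
          _ = _ := by ring
      calc |densityRatio (n + 1) r - 1| ≤ |densityRatio (n + 1) r| + |1| := abs_sub _ _
        _ ≤ B := by
          rw [densityRatio, ← hs, abs_mul, abs_of_nonneg hs0, abs_one, hB]
          gcongr
    refine ⟨A + B, by positivity, fun r hr => ?_⟩
    rcases le_total 1 r with h1 | h1
    · have hr2 : 1 ≤ r ^ 2 := one_le_pow₀ h1
      refine ⟨(hlarge r h1).trans ((div_le_self hA0 hr2).trans (by linarith)),
        (hlarge r h1).trans ?_⟩
      gcongr; linarith
    · have hr2 : r ^ 2 ≤ 1 := pow_le_one₀ hr.le h1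
      have h := hsmall r hr h1
      refine ⟨by linarith, h.trans ?_⟩
      rw [le_div_iff₀ (by positivity)]
      nlinarith

/-- A density of the product of `n + 1` independent standard Gaussians on `(0, ∞)`. -/
noncomputable def productDensity (n : ℕ) (x : ℝ) : ℝ :=
  2 ^ (n / 2 : ℝ) / √(2 * π * (n + 1)) * x ^ (1 / (n + 1) - 1 : ℝ) *
    exp (-((n + 1) * x ^ (2 / (n + 1) : ℝ)) / 2) * densityRatio n (x ^ (1 / (n + 1) : ℝ))

theorem measurable_productDensity (n : ℕ) : Measurable (productDensity n) := by
  have h : Measurable fun x : ℝ => densityRatio n (x ^ (1 / (n + 1) : ℝ)) :=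
    (measurable_densityRatio n).comp (by fun_prop)
  unfold productDensity
  fun_prop

theorem productDensity_pow (n : ℕ) {r : ℝ} (hr : 0 < r) :
    productDensity n (r ^ (n + 1)) = 2 ^ (n / 2 : ℝ) / √(2 * π * (n + 1)) * (r ^ n)⁻¹ *
      exp (-((n + 1) * r ^ 2) / 2) * densityRatio n r := by
  have hn : (n : ℝ) + 1 ≠ 0 := by positivity
  have e : ∀ s : ℝ, (r ^ (n + 1)) ^ (s / (n + 1) : ℝ) = r ^ s := fun s => by
    rw [← rpow_natCast, ← rpow_mul hr.le]
    congr 1; push_cast; field_simp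
  have e1 : (r ^ (n + 1)) ^ (1 / (n + 1) - 1 : ℝ) = (r ^ n)⁻¹ := by
    rw [show (1 / (n + 1) - 1 : ℝ) = (-n) / (n + 1) by field_simp; ring, e, rpow_neg hr.le,
      rpow_natCast]
  rw [productDensity, e1, e, e, rpow_one]
  norm_num

theorem leading_coeff_succ (n : ℕ) :
    2 ^ ((n + 1 : ℕ) / 2 : ℝ) / √(2 * π * ((n + 1 : ℕ) + 1)) * √((n + 1) * (n + 2) / π) =
      2 * (n + 1) * ((√(2 * π))⁻¹ * (2 ^ (n / 2 : ℝ) / √(2 * π * (n + 1)))) := by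
  have h1 : (2 : ℝ) ^ ((n + 1 : ℕ) / 2 : ℝ) = 2 ^ (n / 2 : ℝ) * √2 := by
    rw [sqrt_eq_rpow, ← rpow_add two_pos]; congr 1; push_cast; ring
  have h2 : (((n + 1 : ℕ) : ℝ) + 1) = n + 2 := by push_cast; ring
  have hn : (0 : ℝ) < n + 1 := by positivity
  have hn2 : (0 : ℝ) < n + 2 := by positivity
  have s1 := sqrt_pos.2 hn
  have s2 := sqrt_pos.2 hn2
  have s3 := sqrt_pos.2 pi_pos
  have s4 := sqrt_pos.2 (zero_lt_two (α := ℝ))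
  have q1 := sq_sqrt hn.le
  have q4 := sq_sqrt (zero_le_two (α := ℝ))
  rw [h1, h2, sqrt_div (by positivity), sqrt_mul (by positivity), sqrt_mul (by positivity),
    sqrt_mul (by positivity), sqrt_mul (by positivity) ((n : ℝ) + 1)]
  field_simp
  rw [q1, sqrt_mul zero_le_two]
  linear_combination (√π * (n + 1)) * q4

theorem gaussian_mul_productDensity_eq (n : ℕ) {r : ℝ} (hr : 0 < r) (u : ℝ) :
    gaussianPDFReal 0 1 (r * exp ((n + 1) * u)) * productDensity n ((r * exp (-u)) ^ (n + 1)) =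
      (√(2 * π))⁻¹ * (2 ^ (n / 2 : ℝ) / √(2 * π * (n + 1))) * (r ^ n)⁻¹ *
        exp (-((n + 2) * r ^ 2) / 2) * (exp (-(r ^ 2 * phase (n + 1) u)) *
          (exp (n * u) * densityRatio n (r * exp (-u)))) := by
  rw [productDensity_pow n (by positivity), gaussianPDFReal]
  have e1 : ((r * exp (-u)) ^ n)⁻¹ = (r ^ n)⁻¹ * exp (n * u) := by
    rw [mul_pow, mul_inv, ← exp_nat_mul, ← exp_neg]; congr 2; ring
  have e2 : (r * exp ((n + 1) * u)) ^ 2 = r ^ 2 * exp (2 * (n + 1) * u) := by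
    rw [mul_pow, ← exp_nat_mul]; congr 2; push_cast; ring
  have e3 : (r * exp (-u)) ^ 2 = r ^ 2 * exp (-2 * u) := by
    rw [mul_pow, ← exp_nat_mul]; congr 2; push_cast; ring
  have e4 : exp (-(r ^ 2 * exp (2 * (n + 1) * u)) / 2) *
      exp (-((n + 1) * (r ^ 2 * exp (-2 * u))) / 2) =
      exp (-((n + 2) * r ^ 2) / 2) * exp (-(r ^ 2 * phase (n + 1) u)) := by
    rw [← exp_add, ← exp_add, phase]; congr 1; ring
  simp only [NNReal.coe_one, mul_one, sub_zero]
  rw [e1, e2, e3]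
  linear_combination (√(2 * π))⁻¹ * (2 ^ (n / 2 : ℝ) / √(2 * π * (n + 1))) * (r ^ n)⁻¹ *
    exp (n * u) * densityRatio n (r * exp (-u)) * e4

theorem productDensity_succ_pow (n : ℕ) {r : ℝ} (hr : 0 < r) :
    productDensity (n + 1) (r ^ (n + 2)) = 2 * ((n + 1) * ∫ u,
      gaussianPDFReal 0 1 (r * exp ((n + 1) * u)) * productDensity n ((r * exp (-u)) ^ (n + 1))) := by
  simp only [gaussian_mul_productDensity_eq n hr]
  rw [integral_const_mul, productDensity_pow (n + 1) hr, densityRatio]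
  have e : ((n + 1 : ℕ) : ℝ) + 1 = n + 2 := by push_cast; ring
  have h := leading_coeff_succ n
  rw [e] at h ⊢
  set I := ∫ u, exp (-(r ^ 2 * phase (n + 1) u)) * (exp (n * u) * densityRatio n (r * exp (-u)))
  have hpow : (r ^ (n + 1))⁻¹ * r = (r ^ n)⁻¹ := by
    rw [pow_succ]; field_simp
  linear_combination (r ^ n)⁻¹ * exp (-((n + 2) * r ^ 2) / 2) * I * h +
    2 ^ ((n + 1 : ℕ) / 2 : ℝ) / √(2 * π * (n + 2)) * √((n + 1) * (n + 2) / π) *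
      exp (-((n + 2) * r ^ 2) / 2) * I * hpow

theorem integrable_gaussian_mul_productDensity (n : ℕ) {r : ℝ} (hr : 0 < r) :
    Integrable fun u => gaussianPDFReal 0 1 (r * exp ((n + 1) * u)) *
      productDensity n ((r * exp (-u)) ^ (n + 1)) := by
  obtain ⟨C, hC, h⟩ := exists_abs_densityRatio_sub_one_le n
  simp only [gaussian_mul_productDensity_eq n hr]
  refine (integrable_densityRatio_integrand n (C := C + 1) hr fun s hs => ?_).const_mul _
  calc |densityRatio n s| = |(densityRatio n s - 1) + 1| := by ring_nf
    _ ≤ |densityRatio n s - 1| + |1| := abs_add_le _ _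
    _ ≤ _ := by rw [abs_one]; gcongr; exact (h s hs).1

theorem productDensity_nonneg (n : ℕ) {x : ℝ} (hx : 0 < x) : 0 ≤ productDensity n x := by
  have := densityRatio_nonneg n _ (rpow_pos_of_pos hx (1 / (n + 1)))
  unfold productDensity
  positivity

theorem lintegral_comp_abs {f : ℝ → ℝ≥0∞} : ∫⁻ x, f |x| = 2 * ∫⁻ x in Ioi (0 : ℝ), f x := by
  have h1 : ∫⁻ x in Ioi (0 : ℝ), f |x| = ∫⁻ x in Ioi (0 : ℝ), f x :=
    setLIntegral_congr_fun measurableSet_Ioi fun x (hx : 0 < x) => by simp only [abs_of_pos hx]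
  have h2 : ∫⁻ x in Iio (0 : ℝ), f |x| = ∫⁻ x in Ioi (0 : ℝ), f |x| := by
    have := (Measure.measurePreserving_neg (volume : Measure ℝ)).setLIntegral_comp_preimage_emb
      (MeasurableEquiv.neg ℝ).measurableEmbedding (fun x => f |x|) (Ioi 0)
    simpa using this
  have h3 : ∫⁻ x in Iic (0 : ℝ), f |x| = ∫⁻ x in Iio (0 : ℝ), f |x| :=
    setLIntegral_congr Iio_ae_eq_Iic.symm
  rw [← setLIntegral_univ, ← Iic_union_Ioi (a := (0 : ℝ)),
    lintegral_union measurableSet_Ioi (Iic_disjoint_Ioi le_rfl), h3, h2, h1, two_mul]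

theorem image_mul_exp {r a : ℝ} (hr : 0 < r) (ha : 0 < a) :
    (fun u : ℝ => r * exp (a * u)) '' univ = Ioi 0 := by
  ext t
  simp only [image_univ, mem_range, mem_Ioi]
  constructor
  · rintro ⟨u, rfl⟩; positivity
  · intro ht
    refine ⟨log (t / r) / a, ?_⟩
    rw [mul_div_cancel₀ _ ha.ne', exp_log (by positivity)]
    field_simp

theorem lintegral_gaussian_mul_productDensity (n : ℕ) {z : ℝ} (hz : z ≠ 0) :
    ∫⁻ t, ENNReal.ofReal (gaussianPDFReal 0 1 t) *
      (ENNReal.ofReal (productDensity n |z / t|) * ENNReal.ofReal |t⁻¹|) =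
      ENNReal.ofReal (productDensity (n + 1) |z|) := by
  have hz0 : 0 < |z| := abs_pos.2 hz
  obtain ⟨r, hr, hrz⟩ : ∃ r : ℝ, 0 < r ∧ r ^ (n + 2) = |z| :=
    ⟨|z| ^ ((n + 2 : ℕ) : ℝ)⁻¹, by positivity, rpow_inv_natCast_pow hz0.le (by omega)⟩
  have hn : (0 : ℝ) < n + 1 := by positivity
  have hderiv : ∀ u ∈ (univ : Set ℝ), HasDerivWithinAt (fun u : ℝ => r * exp ((n + 1) * u))
      (r * (exp ((n + 1) * u) * (n + 1))) univ u := fun u _ => by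
    have h := ((hasDerivAt_id u).const_mul ((n : ℝ) + 1)).exp.const_mul r
    simpa using h
  have hinj : InjOn (fun u : ℝ => r * exp ((n + 1) * u)) univ := by
    intro u _ v _ h
    have := exp_injective (mul_left_cancel₀ hr.ne' h)
    exact mul_left_cancel₀ hn.ne' this
  have habs : ∀ t : ℝ, ENNReal.ofReal (gaussianPDFReal 0 1 t) *
      (ENNReal.ofReal (productDensity n |z / t|) * ENNReal.ofReal |t⁻¹|) =
      ENNReal.ofReal (gaussianPDFReal 0 1 |t|) *
      (ENNReal.ofReal (productDensity n (|z| / |t|)) * ENNReal.ofReal |t|⁻¹) := fun t => by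
    rw [abs_div, abs_inv]; simp [gaussianPDFReal]
  simp only [habs]
  rw [lintegral_comp_abs (f := fun t => ENNReal.ofReal (gaussianPDFReal 0 1 t) *
      (ENNReal.ofReal (productDensity n (|z| / t)) * ENNReal.ofReal t⁻¹)), ← image_mul_exp hr hn,
    lintegral_image_eq_lintegral_abs_deriv_mul MeasurableSet.univ hderiv hinj, ← hrz,
    productDensity_succ_pow n hr, ← integral_const_mul, setLIntegral_univ,
    ENNReal.ofReal_mul two_pos.le, ENNReal.ofReal_ofNat, ofReal_integral_eq_lintegral_ofReal
      ((integrable_gaussian_mul_productDensity n hr).const_mul _)]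
  · congr 1
    refine lintegral_congr fun u => ?_
    have hp : 0 ≤ productDensity n ((r * exp (-u)) ^ (n + 1)) :=
      productDensity_nonneg n (by positivity)
    have hg := gaussianPDFReal_nonneg 0 1 (r * exp ((n + 1) * u))
    have hq : r ^ (n + 2) / (r * exp ((n + 1) * u)) = (r * exp (-u)) ^ (n + 1) := by
      rw [mul_pow, ← exp_nat_mul, pow_succ' r (n + 1), mul_div_mul_left _ _ hr.ne', div_eq_mul_inv,
        ← exp_neg]
      congr 2; push_cast; ring
    rw [hq, ← ENNReal.ofReal_mul hp, ← ENNReal.ofReal_mul hg, ← ENNReal.ofReal_mul (abs_nonneg _),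
      abs_of_pos (by positivity)]
    congr 1
    field_simp
  · refine ae_of_all _ fun u => ?_
    have hp : 0 ≤ productDensity n ((r * exp (-u)) ^ (n + 1)) :=
      productDensity_nonneg n (by positivity)
    have hg := gaussianPDFReal_nonneg 0 1 (r * exp ((n + 1) * u))
    simp only [Pi.zero_apply]
    positivity

theorem map_mul_prod_withDensity {f g : ℝ → ℝ≥0∞} (hf : Measurable f) (hg : Measurable g) :
    (((volume : Measure ℝ).withDensity f).prod (volume.withDensity g)).map (fun p => p.1 * p.2) =
      volume.withDensity fun z => ∫⁻ t, f t * (g (z / t) * ENNReal.ofReal |t⁻¹|) := by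
  ext B hB
  have hm : Measurable fun p : ℝ × ℝ => p.1 * p.2 := by fun_prop
  rw [Measure.map_apply hm hB, Measure.prod_apply (hm hB), withDensity_apply _ hB,
    lintegral_withDensity_eq_lintegral_mul _ hf (measurable_measure_prodMk_left (hm hB)),
    lintegral_lintegral_swap (by fun_prop)]
  refine lintegral_congr_ae ?_
  filter_upwards [compl_mem_ae_iff.2 (measure_singleton (0 : ℝ))] with t ht
  have ht0 : t ≠ 0 := ht
  have hmt : Measurable fun y : ℝ => t * y := by fun_prop
  have hF : Measurable (B.indicator fun z => g (z / t)) :=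
    Measurable.indicator (by fun_prop) hB
  have hpre : Prod.mk t ⁻¹' ((fun p : ℝ × ℝ => p.1 * p.2) ⁻¹' B) = (fun y => t * y) ⁻¹' B := rfl
  rw [Pi.mul_apply, lintegral_const_mul _ (by fun_prop), lintegral_mul_const _ (by fun_prop), hpre,
    withDensity_apply _ (hmt hB), ← lintegral_indicator (hmt hB), ← lintegral_indicator hB]
  congr 1
  calc ∫⁻ y, ((fun y => t * y) ⁻¹' B).indicator g y
      = ∫⁻ y, B.indicator (fun z => g (z / t)) (t * y) := by
        refine lintegral_congr fun y => ?_
        simp only [indicator, mem_preimage, mul_div_cancel_left₀ y ht0]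
        rfl
    _ = ∫⁻ z, B.indicator (fun z => g (z / t)) z ∂(volume.map fun y => t * y) :=
        (lintegral_map hF hmt).symm
    _ = _ := by
        rw [Real.map_volume_mul_left ht0, lintegral_smul_measure, smul_eq_mul, mul_comm]

theorem map_prod_pi_succ (n : ℕ) (γ : Measure ℝ) [SigmaFinite γ] :
    (Measure.pi fun _ : Fin (n + 1) => γ).map (fun y => ∏ i, y i) =
      (γ.prod ((Measure.pi fun _ : Fin n => γ).map fun y => ∏ i, y i)).map
        (fun p => p.1 * p.2) := by
  have hprod : Measurable fun y : Fin n → ℝ => ∏ i, y i := by fun_prop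
  have hmul : Measurable fun p : ℝ × ℝ => p.1 * p.2 := by fun_prop
  have h := measurePreserving_piFinSuccAbove (fun _ : Fin (n + 1) => γ) 0
  have h1 := Measure.map_prod_map γ (Measure.pi fun _ : Fin n => γ) (measurable_id (α := ℝ)) hprod
  rw [Measure.map_id] at h1
  have hid : Measurable (Prod.map (id : ℝ → ℝ) fun y : Fin n → ℝ => ∏ i, y i) :=
    measurable_id.prodMap hprod
  rw [h1, ← h.map_eq, Measure.map_map hid (MeasurableEquiv.measurable _),
    Measure.map_map hmul (hid.comp (MeasurableEquiv.measurable _))]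
  congr 1
  ext y
  exact Fin.prod_univ_succ y

theorem map_prod_pi_gaussian (n : ℕ) :
    (Measure.pi fun _ : Fin (n + 1) => gaussianReal 0 1).map (fun y => ∏ i, y i) =
      volume.withDensity fun x => ENNReal.ofReal (productDensity n |x|) := by
  induction n with
  | zero =>
    have h := measurePreserving_eval (fun _ : Fin 1 => gaussianReal 0 1) 0
    simp only [Nat.reduceAdd, Finset.univ_unique, Fin.default_eq_zero, Fin.isValue,
      Finset.prod_singleton]
    refine h.map_eq.trans ?_
    rw [gaussianReal_of_var_ne_zero _ one_ne_zero]
    congr 1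
    ext x
    rw [gaussianPDF]
    congr 1
    simp [gaussianPDFReal, productDensity, densityRatio]
  | succ n ih =>
    have hm : Measurable fun x => ENNReal.ofReal (productDensity n |x|) :=
      ((measurable_productDensity n).comp (by fun_prop : Measurable fun x : ℝ => |x|)).ennreal_ofReal
    rw [map_prod_pi_succ, ih, gaussianReal_of_var_ne_zero _ one_ne_zero,
      map_mul_prod_withDensity (measurable_gaussianPDF 0 1) hm]
    refine withDensity_congr_ae ?_
    filter_upwards [compl_mem_ae_iff.2 (measure_singleton (0 : ℝ))] with z hz
    exact lintegral_gaussian_mul_productDensity n hz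

theorem isBigO_productDensity_sub (n : ℕ) :
    (fun x : ℝ => productDensity n x - 2 ^ (n / 2 : ℝ) / √(2 * π * (n + 1)) *
        x ^ (1 / (n + 1) - 1 : ℝ) * exp (-((n + 1) * x ^ (2 / (n + 1) : ℝ)) / 2))
      =O[atTop] fun x : ℝ => x ^ (1 / (n + 1) - 1 : ℝ) *
        exp (-((n + 1) * x ^ (2 / (n + 1) : ℝ)) / 2) * x ^ (-2 / (n + 1) : ℝ) := by
  obtain ⟨C, hC, h⟩ := exists_abs_densityRatio_sub_one_le n
  set c := (2 : ℝ) ^ (n / 2 : ℝ) / √(2 * π * (n + 1)) with hc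
  have hc0 : 0 ≤ c := by positivity
  refine IsBigO.of_bound (c * C) ?_
  filter_upwards [eventually_gt_atTop (0 : ℝ)] with x hx
  have hr : 0 < x ^ (1 / (n + 1) : ℝ) := by positivity
  have e : C / (x ^ (1 / (n + 1) : ℝ)) ^ 2 = C * x ^ (-2 / (n + 1) : ℝ) := by
    rw [← rpow_natCast, ← rpow_mul hx.le, div_eq_mul_inv, ← rpow_neg hx.le]
    congr 2; push_cast; ring
  set P := x ^ (1 / (n + 1) - 1 : ℝ) * exp (-((n + 1) * x ^ (2 / (n + 1) : ℝ)) / 2) with hP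
  have hP0 : 0 ≤ P := by positivity
  have hx2 : 0 ≤ x ^ (-2 / (n + 1) : ℝ) := by positivity
  calc _ = ‖c * P * (densityRatio n (x ^ (1 / (n + 1) : ℝ)) - 1)‖ := by
        rw [productDensity, ← hc, hP]; congr 1; ring
    _ = c * P * |densityRatio n (x ^ (1 / (n + 1) : ℝ)) - 1| := by
        rw [norm_mul, norm_of_nonneg (by positivity), norm_eq_abs]
    _ ≤ c * P * (C * x ^ (-2 / (n + 1) : ℝ)) := by
        rw [← e]; gcongr; exact (h _ hr).2
    _ = c * C * ‖P * x ^ (-2 / (n + 1) : ℝ)‖ := by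
        rw [norm_of_nonneg (by positivity)]; ring

/-- for `η_1, …, η_d` i.i.d. `N(0,1)`, `d ≥ 2`, the product `η_1 ⋯ η_d` has a
density `p` on `(0,∞)` with
`p(x) = (2^{(d−1)/2}/√(2πd)) x^{1/d−1} e^{−d x^{2/d}/2} (1 + O(x^{−2/d}))` as `x → ∞`. -/
theorem density_product_gaussians
    (d : ℕ) (hd : 2 ≤ d) :
    ∃ p : ℝ → ℝ,
      (Measure.map (fun y : EuclideanSpace ℝ (Fin d) => ∏ i, y i)
          (stdGaussian d)).restrict (Set.Ioi 0)
        = (volume.restrict (Set.Ioi 0)).withDensity (fun x => ENNReal.ofReal (p x)) ∧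
      (fun x : ℝ =>
          p x - (2 ^ (((d : ℝ) - 1) / 2) / Real.sqrt (2 * π * d)) * x ^ ((1:ℝ) / d - 1)
            * Real.exp (-(d * x ^ ((2:ℝ) / d)) / 2))
        =O[atTop]
      fun x : ℝ =>
        x ^ ((1:ℝ) / d - 1) * Real.exp (-(d * x ^ ((2:ℝ) / d)) / 2) * x ^ (-(2:ℝ) / d) := by
  obtain ⟨n, rfl⟩ : ∃ n, d = n + 1 := ⟨d - 1, by omega⟩
  refine ⟨productDensity n, ?_, ?_⟩
  · rw [_root_.stdGaussian, Measure.map_map (by fun_prop) (by fun_prop)]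
    refine (congrArg (fun μ => μ.restrict (Ioi 0)) (map_prod_pi_gaussian n)).trans ?_
    rw [restrict_withDensity measurableSet_Ioi]
    refine withDensity_congr_ae ?_
    filter_upwards [ae_restrict_mem measurableSet_Ioi] with x hx
    rw [abs_of_pos hx]
  · have h := isBigO_productDensity_sub n
    push_cast
    rwa [add_sub_cancel_right]
end

section
/- Let η_1, …, η_n be independent standard normal random variables (a one-dimensional Gaussian cloud of n points, n ≥ 2) and let D_n = max_{1 ≤ k < l ≤ n} |η_k − η_l| be its diameter. Then as x → ∞, P(D_n > x) = (n(n−1)/(√π · x)) e^{−x²/4} (1 + O(1/x²)). -/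
open MeasureTheory ProbabilityTheory Real Filter Asymptotics Set
open scoped Topology ENNReal

/-- A linear combination of independent standard normal variables is a centred normal variable
whose variance is the sum of the squared coefficients. -/
lemma map_sum_mul_pi_gaussianReal {ι : Type*} [Fintype ι] (c : ι → ℝ) :
    (Measure.pi fun _ : ι => gaussianReal 0 1).map (fun y => ∑ i, c i * y i)
      = gaussianReal 0 (∑ i, c i ^ 2).toNNReal := by
  classical
  have hmeas : ∀ i, Measurable fun y : ι → ℝ => c i * y i := fun i => by fun_prop
  have hindep : iIndepFun (fun i (y : ι → ℝ) => c i * y i)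
      (Measure.pi fun _ : ι => gaussianReal 0 1) :=
    iIndepFun_pi (X := fun i x => c i * x) fun i => by fun_prop
  have hlaw : ∀ i, (Measure.pi fun _ : ι => gaussianReal 0 1).map (fun y => c i * y i)
      = gaussianReal 0 (c i ^ 2).toNNReal := by
    intro i
    have h := gaussianReal_map_const_mul (μ := 0) (v := 1) (c i)
    rw [← (measurePreserving_eval (fun _ : ι => gaussianReal 0 1) i).map_eq,
      Measure.map_map (by fun_prop) (by fun_prop)] at h
    rw [mul_zero, mul_one] at h
    rwa [Real.toNNReal_of_nonneg (sq_nonneg _)]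
  have key : ∀ s : Finset ι, (Measure.pi fun _ : ι => gaussianReal 0 1).map
      (∑ i ∈ s, fun y : ι → ℝ => c i * y i) = gaussianReal 0 (∑ i ∈ s, c i ^ 2).toNNReal := by
    intro s
    induction s using Finset.induction_on with
    | empty =>
      simp only [Finset.sum_empty, Real.toNNReal_zero, gaussianReal_zero_var]
      rw [show (0 : (ι → ℝ) → ℝ) = fun _ => (0 : ℝ) from rfl, Measure.map_const]
      simp
    | insert a s ha ih =>
      rw [Finset.sum_insert ha, Finset.sum_insert ha,
        Real.toNNReal_add (sq_nonneg _) (Finset.sum_nonneg fun i _ => sq_nonneg _)]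
      have h := gaussianReal_add_gaussianReal_of_indepFun
        (hindep.indepFun_finsetSum_of_notMem hmeas ha).symm (hlaw a) ih
      rwa [add_zero] at h
  convert key Finset.univ using 2
  ext y
  simp

/-- The Chernoff bound for a linear combination of independent standard normal variables. -/
lemma pi_gaussianReal_real_le_exp {ι : Type*} [Fintype ι] (c : ι → ℝ) {v : ℝ}
    (hv : ∑ i, c i ^ 2 ≤ v) {t : ℝ} (ht : 0 ≤ t) (b : ℝ) :
    (Measure.pi fun _ : ι => gaussianReal 0 1).real {y | b ≤ ∑ i, c i * y i}
      ≤ Real.exp (-t * b + v * t ^ 2 / 2) := by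
  have hmgf := mgf_gaussianReal (map_sum_mul_pi_gaussianReal c) t
  rw [Real.coe_toNNReal _ (Finset.sum_nonneg fun i _ => sq_nonneg _), zero_mul, zero_add] at hmgf
  have hint : Integrable (fun y => Real.exp (t * ∑ i, c i * y i))
      (Measure.pi fun _ : ι => gaussianReal 0 1) := by
    rw [← mgf_pos_iff (X := fun y : ι → ℝ => ∑ i, c i * y i), hmgf]
    exact Real.exp_pos _
  refine (measure_ge_le_exp_mul_mgf b ht hint).trans ?_
  rw [hmgf, ← Real.exp_add]
  gcongr

/-- Mills' ratio estimate for the tail of the centred normal law with variance `2`. -/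
lemma gaussianReal_two_Ioi_bounds {x : ℝ} (hx : 0 < x) :
    |(gaussianReal 0 2).real (Ioi x) - 1 / (√π * x) * Real.exp (-(x ^ 2) / 4)|
      ≤ 1 / (√π * x) * Real.exp (-(x ^ 2) / 4) * (2 * (x ^ 2)⁻¹) := by
  have hderiv : ∀ u ∈ Ici x, HasDerivAt (fun u : ℝ => -(2 / u * Real.exp (-(u ^ 2) / 4)))
      ((1 + 2 / u ^ 2) * Real.exp (-(u ^ 2) / 4)) u := by
    intro u hu
    have hu0 : u ≠ 0 := (hx.trans_le hu).ne'
    have h1 : HasDerivAt (fun u : ℝ => 2 / u) (-2 / u ^ 2) u := by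
      simpa [div_eq_mul_inv] using (hasDerivAt_inv hu0).const_mul (2 : ℝ)
    have h2 : HasDerivAt (fun u : ℝ => Real.exp (-(u ^ 2) / 4))
        (Real.exp (-(u ^ 2) / 4) * (-(2 * u) / 4)) u := by
      simpa using ((hasDerivAt_pow 2 u).neg.div_const 4).exp
    refine (h1.mul h2).neg.congr_deriv ?_
    field_simp
    ring
  have hlim : Tendsto (fun u : ℝ => -(2 / u * Real.exp (-(u ^ 2) / 4))) atTop (𝓝 0) := by
    have h1 : Tendsto (fun u : ℝ => 2 / u) atTop (𝓝 0) := tendsto_const_nhds.div_atTop tendsto_id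
    have h2 : Tendsto (fun u : ℝ => Real.exp (-(u ^ 2) / 4)) atTop (𝓝 0) := by
      refine Real.tendsto_exp_atBot.comp ?_
      have := (tendsto_pow_atTop (α := ℝ) two_ne_zero).atTop_div_const (by norm_num : (0:ℝ) < 4)
      simpa [neg_div, Function.comp_def] using tendsto_neg_atTop_atBot.comp this
    simpa using (h1.mul h2).neg
  have hpos : ∀ u ∈ Ioi x, 0 ≤ (1 + 2 / u ^ 2) * Real.exp (-(u ^ 2) / 4) := fun u _ => by
    positivity
  have hint := integrableOn_Ioi_deriv_of_nonneg' hderiv hpos hlim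
  have hI := integral_Ioi_of_hasDerivAt_of_nonneg' hderiv hpos hlim
  rw [zero_sub, neg_neg] at hI
  have hexp : IntegrableOn (fun u : ℝ => Real.exp (-(u ^ 2) / 4)) (Ioi x) := by
    refine hint.mono' (by fun_prop) (ae_of_all _ fun u => ?_)
    rw [Real.norm_of_nonneg (Real.exp_pos _).le]
    exact le_mul_of_one_le_left (Real.exp_pos _).le (le_add_of_nonneg_right (by positivity))
  set J := ∫ u in Ioi x, Real.exp (-(u ^ 2) / 4) with hJ
  have hupper : J ≤ 2 / x * Real.exp (-(x ^ 2) / 4) := by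
    rw [← hI]
    refine integral_mono hexp hint fun u => ?_
    exact le_mul_of_one_le_left (Real.exp_pos _).le (le_add_of_nonneg_right (by positivity))
  have hlower : 2 / x * Real.exp (-(x ^ 2) / 4) ≤ (1 + 2 / x ^ 2) * J := by
    rw [← hI, hJ, ← integral_const_mul]
    refine setIntegral_mono_on hint (hexp.const_mul _) measurableSet_Ioi fun u hu => ?_
    have : x ≤ u := (mem_Ioi.mp hu).le
    gcongr
  have htail : (gaussianReal 0 2).real (Ioi x) = (2 * √π)⁻¹ * J := by
    rw [measureReal_def, gaussianReal_apply_eq_integral _ (by norm_num), ENNReal.toReal_ofReal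
      (integral_nonneg fun u => gaussianPDFReal_nonneg _ _ _), hJ, ← integral_const_mul]
    have h4 : √(2 * π * 2) = 2 * √π := by
      rw [show 2 * π * 2 = 2 ^ 2 * π by ring, Real.sqrt_mul (by norm_num),
        Real.sqrt_sq (by norm_num)]
    refine setIntegral_congr_fun measurableSet_Ioi fun u _ => ?_
    simp only [gaussianPDFReal, NNReal.coe_ofNat, sub_zero, h4]
    norm_num
  have hsqrt : 0 < √π := Real.sqrt_pos.mpr Real.pi_pos
  have hmain : 1 / (√π * x) * Real.exp (-(x ^ 2) / 4)
      = (2 * √π)⁻¹ * (2 / x * Real.exp (-(x ^ 2) / 4)) := by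
    field_simp
  rw [htail, hmain, abs_sub_comm, ← mul_sub, abs_of_nonneg
    (mul_nonneg (by positivity) (sub_nonneg.mpr hupper)), mul_assoc]
  gcongr
  calc 2 / x * Real.exp (-(x ^ 2) / 4) - J ≤ J * (2 * (x ^ 2)⁻¹) := by
        rw [div_eq_mul_inv 2 (x ^ 2)] at hlower
        linarith
    _ ≤ _ := by gcongr

/-- A Bonferroni inequality with a uniform bound on the pairwise intersections. -/
lemma sum_measureReal_le_biUnion_add {Ω β : Type*} [MeasurableSpace Ω] (μ : Measure Ω)
    [IsFiniteMeasure μ] (A : β → Set Ω) (hA : ∀ p, MeasurableSet (A p)) {ε : ℝ} (hε : 0 ≤ ε)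
    (s : Finset β) (hpair : ∀ p ∈ s, ∀ q ∈ s, p ≠ q → μ.real (A p ∩ A q) ≤ ε) :
    ∑ p ∈ s, μ.real (A p) ≤ μ.real (⋃ p ∈ s, A p) + (s.card : ℝ) ^ 2 * ε := by
  classical
  induction s using Finset.induction_on with
  | empty => simp
  | insert a s ha ih =>
    have hs := ih fun p hp q hq =>
      hpair p (Finset.mem_insert_of_mem hp) q (Finset.mem_insert_of_mem hq)
    have hinter : μ.real (A a ∩ ⋃ p ∈ s, A p) ≤ s.card * ε := by
      rw [inter_iUnion₂]
      refine (measureReal_biUnion_finset_le s _).trans ?_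
      rw [← nsmul_eq_mul]
      refine Finset.sum_le_card_nsmul _ _ _ fun p hp => ?_
      exact hpair a (Finset.mem_insert_self a s) p (Finset.mem_insert_of_mem hp)
        fun h => ha (h ▸ hp)
    have hunion := measureReal_union_add_inter (μ := μ) (s := A a)
      (s.measurableSet_biUnion fun p _ => hA p) (measure_ne_top _ _) (measure_ne_top _ _)
    rw [Finset.sum_insert ha, Finset.card_insert_of_notMem ha, Finset.set_biUnion_insert]
    push_cast
    nlinarith [mul_nonneg (Nat.cast_nonneg (α := ℝ) s.card) hε]

/-- Two distinct vectors of the form `e_k - e_l` have a sum of squared norm at most `6`. -/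
lemma sum_sq_single_sub_single_add_le {ι : Type*} [Fintype ι] [DecidableEq ι] {p q : ι × ι}
    (hp : p.1 ≠ p.2) (hq : q.1 ≠ q.2) (hpq : p ≠ q) :
    ∑ i, ((Pi.single p.1 1 - Pi.single p.2 1 + (Pi.single q.1 1 - Pi.single q.2 1) : ι → ℝ) i) ^ 2
      ≤ 6 := by
  obtain ⟨k, l⟩ := p
  obtain ⟨k', l'⟩ := q
  simp only [ne_eq, Prod.mk.injEq] at hp hq hpq
  simp only [Pi.add_apply, Pi.sub_apply, Pi.single_apply, sq, mul_add, mul_sub,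
    Finset.sum_add_distrib, Finset.sum_sub_distrib, mul_ite, mul_one, mul_zero,
    Finset.sum_ite_eq', Finset.mem_univ, if_true]
  split_ifs <;> first | (norm_num; done) | (exfalso; grind)

lemma sum_single_sub_single_mul {ι : Type*} [Fintype ι] [DecidableEq ι] (k l : ι) (y : ι → ℝ) :
    ∑ i, (Pi.single k 1 - Pi.single l 1 : ι → ℝ) i * y i = y k - y l := by
  simp [Pi.single_apply, sub_mul]

/-- The tail of the difference of two independent standard normal variables. -/
lemma pi_gaussianReal_real_lt_sub {ι : Type*} [Fintype ι] {k l : ι} (hkl : k ≠ l) (x : ℝ) :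
    (Measure.pi fun _ : ι => gaussianReal 0 1).real {y | x < y k - y l}
      = (gaussianReal 0 2).real (Ioi x) := by
  classical
  have hvar : ∑ i, (Pi.single k 1 - Pi.single l 1 : ι → ℝ) i ^ 2 = 2 := by
    simp only [Pi.sub_apply, Pi.single_apply, sq, mul_sub,
      Finset.sum_sub_distrib, mul_ite, mul_one, mul_zero,
      Finset.sum_ite_eq', Finset.mem_univ, if_true, if_neg hkl, if_neg hkl.symm]
    norm_num
  have h := map_sum_mul_pi_gaussianReal (Pi.single k 1 - Pi.single l 1 : ι → ℝ)
  simp only [hvar, sum_single_sub_single_mul] at h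
  rw [Real.toNNReal_ofNat] at h
  rw [← h, map_measureReal_apply (by fun_prop) measurableSet_Ioi]
  rfl

/-- Two distinct ordered differences exceed `x` simultaneously with probability at most
`exp (-x² / 3)`. -/
lemma pi_gaussianReal_real_inter_le {ι : Type*} [Fintype ι] {p q : ι × ι}
    (hp : p.1 ≠ p.2) (hq : q.1 ≠ q.2) (hpq : p ≠ q) {x : ℝ} (hx : 0 ≤ x) :
    (Measure.pi fun _ : ι => gaussianReal 0 1).real
      ({y | x < y p.1 - y p.2} ∩ {y | x < y q.1 - y q.2}) ≤ Real.exp (-(x ^ 2) / 3) := by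
  classical
  refine le_trans (measureReal_mono ?_) ((pi_gaussianReal_real_le_exp _
    (sum_sq_single_sub_single_add_le hp hq hpq) (t := x / 3) (by positivity) (2 * x)).trans_eq ?_)
  · rintro y ⟨h1, h2⟩
    simp only [mem_ofPred_eq] at h1 h2 ⊢
    simp_rw [Pi.add_apply, add_mul]
    rw [Finset.sum_add_distrib, sum_single_sub_single_mul, sum_single_sub_single_mul]
    linarith
  · congr 1
    ring

lemma exp_neg_sq_div_three_isBigO :
    (fun x : ℝ => Real.exp (-(x ^ 2) / 3))
      =O[atTop] fun x : ℝ => x⁻¹ * Real.exp (-(x ^ 2) / 4) * (x ^ 2)⁻¹ := by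
  have h : Tendsto (fun x : ℝ => (x ^ 2 / 12) ^ 2 * Real.exp (-(x ^ 2 / 12))) atTop (𝓝 0) :=
    (Real.tendsto_pow_mul_exp_neg_atTop_nhds_zero 2).comp
      ((tendsto_pow_atTop (α := ℝ) two_ne_zero).atTop_div_const (by norm_num : (0:ℝ) < 12))
  refine IsBigO.of_bound 144 ?_
  filter_upwards [h.eventually_le_const (zero_lt_one), eventually_ge_atTop 1] with x hx hx1
  have hx0 : 0 < x := by linarith
  rw [Real.norm_of_nonneg (by positivity), Real.norm_of_nonneg (by positivity)]
  have hsplit : Real.exp (-(x ^ 2) / 3) = Real.exp (-(x ^ 2 / 12)) * Real.exp (-(x ^ 2) / 4) := by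
    rw [← Real.exp_add]
    congr 1
    ring
  have hle : Real.exp (-(x ^ 2 / 12)) ≤ 144 * (x⁻¹ * (x ^ 2)⁻¹) := by
    rw [← mul_inv, ← div_eq_mul_inv, le_div_iff₀ (by positivity)]
    have : x * x ^ 2 ≤ x ^ 4 := by nlinarith [pow_pos hx0 3]
    nlinarith [Real.exp_pos (-(x ^ 2 / 12))]
  rw [hsplit]
  calc _ ≤ 144 * (x⁻¹ * (x ^ 2)⁻¹) * Real.exp (-(x ^ 2) / 4) := by gcongr
    _ = _ := by ring

/-- for `η_1, …, η_n` i.i.d. `N(0,1)` (`n ≥ 2`) and the diameter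
`D_n = max_{k<l} |η_k − η_l|` of the one-dimensional Gaussian cloud,
`P(D_n > x) = (n(n−1)/(√π x)) e^{−x²/4}(1 + O(1/x²))` as `x → ∞`. -/
theorem tail_diameter_gaussian_cloud_dim_one (n : ℕ) (hn : 2 ≤ n) :
    (fun x : ℝ =>
        ((Measure.pi fun _ : Fin n => gaussianReal 0 1)
            {y | ∃ k l : Fin n, k ≠ l ∧ x < |y k - y l|}).toReal
          - (n * (n - 1) / (Real.sqrt π * x)) * Real.exp (-(x ^ 2) / 4))
      =O[atTop]
    fun x : ℝ => (n * (n - 1) / (Real.sqrt π * x)) * Real.exp (-(x ^ 2) / 4) * (x ^ 2)⁻¹ := by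
  set P : Measure (Fin n → ℝ) := Measure.pi fun _ : Fin n => gaussianReal 0 1 with hP
  set s : Finset (Fin n × Fin n) := Finset.univ.offDiag with hs
  have hcard : (s.card : ℝ) = n * (n - 1) := by
    rw [hs, Finset.offDiag_card, Finset.card_univ, Fintype.card_fin, Nat.cast_sub (by nlinarith)]
    push_cast
    ring
  have hn2 : (2 : ℝ) ≤ n := by exact_mod_cast hn
  have hNpos : (0 : ℝ) < n * (n - 1) := by nlinarith
  have hsqrt : 0 < √π := Real.sqrt_pos.mpr Real.pi_pos
  have hunion : ∀ x : ℝ, {y : Fin n → ℝ | ∃ k l : Fin n, k ≠ l ∧ x < |y k - y l|}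
      = ⋃ p ∈ s, {y | x < y p.1 - y p.2} := by
    intro x
    ext y
    simp only [mem_ofPred_eq, mem_iUnion, hs, Finset.mem_offDiag, Finset.mem_univ, true_and,
      exists_prop, Prod.exists]
    constructor
    · rintro ⟨k, l, hkl, h⟩
      rcases lt_abs.mp h with h | h
      · exact ⟨k, l, hkl, h⟩
      · exact ⟨l, k, hkl.symm, by linarith⟩
    · rintro ⟨k, l, hkl, h⟩
      exact ⟨k, l, hkl, h.trans_le (le_abs_self _)⟩
  have hbound : ∀ x : ℝ, 0 < x →
      |(P {y | ∃ k l : Fin n, k ≠ l ∧ x < |y k - y l|}).toReal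
          - (n * (n - 1) / (√π * x)) * Real.exp (-(x ^ 2) / 4)|
        ≤ 2 * ((n * (n - 1) / (√π * x)) * Real.exp (-(x ^ 2) / 4) * (x ^ 2)⁻¹)
          + (n * (n - 1)) ^ 2 * Real.exp (-(x ^ 2) / 3) := by
    intro x hx
    have hne : ∀ p ∈ s, p.1 ≠ p.2 := fun p hp => (Finset.mem_offDiag.mp hp).2.2
    have hsum : ∑ p ∈ s, P.real {y | x < y p.1 - y p.2}
        = n * (n - 1) * (gaussianReal 0 2).real (Ioi x) := by
      rw [Finset.sum_congr rfl fun p hp => pi_gaussianReal_real_lt_sub (hne p hp) x,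
        Finset.sum_const, nsmul_eq_mul, hcard]
    have hupper := measureReal_biUnion_finset_le (μ := P) s
      fun p => {y : Fin n → ℝ | x < y p.1 - y p.2}
    have hlower := sum_measureReal_le_biUnion_add P
      (fun p : Fin n × Fin n => {y : Fin n → ℝ | x < y p.1 - y p.2})
      (fun p => measurableSet_lt (by fun_prop) (by fun_prop))
      (Real.exp_pos (-(x ^ 2) / 3)).le s
      fun p hp q hq hpq => pi_gaussianReal_real_inter_le (hne p hp) (hne q hq) hpq hx.le
    rw [hsum] at hupper hlower
    rw [hcard] at hlower
    rw [hunion x, ← measureReal_def]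
    have hmills := abs_le.mp (gaussianReal_two_Ioi_bounds hx)
    set m := 1 / (√π * x) * Real.exp (-(x ^ 2) / 4) with hm
    have hmain : (n * (n - 1) / (√π * x)) * Real.exp (-(x ^ 2) / 4) = n * (n - 1) * m := by
      rw [hm]
      ring
    have h1 := mul_le_mul_of_nonneg_left hmills.1 hNpos.le
    have h2 := mul_le_mul_of_nonneg_left hmills.2 hNpos.le
    have h3 : 0 ≤ ((n : ℝ) * (n - 1)) ^ 2 * Real.exp (-(x ^ 2) / 3) := by positivity
    rw [hmain, abs_le]
    constructor <;> linarith
  have hexp : (fun x : ℝ => (n * (n - 1) : ℝ) ^ 2 * Real.exp (-(x ^ 2) / 3)) =O[atTop]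
      fun x : ℝ => (n * (n - 1) / (√π * x)) * Real.exp (-(x ^ 2) / 4) * (x ^ 2)⁻¹ := by
    refine (exp_neg_sq_div_three_isBigO.const_mul_left _).trans ?_
    refine (isBigO_refl _ atTop).const_mul_left (√π / (n * (n - 1))) |>.congr_left fun x => ?_
    have : (n : ℝ) - 1 ≠ 0 := by linarith
    field_simp
  refine IsBigO.trans ?_ (((isBigO_refl _ atTop).const_mul_left 2).add hexp)
  refine IsBigO.of_bound 1 ?_
  filter_upwards [eventually_gt_atTop 0] with x hx
  rw [one_mul, Real.norm_eq_abs]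
  exact (hbound x hx).trans (le_abs_self _)
end
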